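/- Under the stated hypotheses there exist δ > 0, 0 < λ < 1 and C > 0 such that for every integer k ≥ 1 there are C¹ functions R_x, R_y : Q_δ → ℝ^{n-1} and R_z : Q_δ → ℝ, defined on Q_δ = {(x₀, y_k, z₀) : ‖x₀‖ ≤ δ, ‖y_k‖ ≤ δ, |z₀| ≤ δ}, with the following properties. (1) Whenever (x_i, y_i, z_i) = Π^i(x₀, y₀, z₀) is defined and satisfies ‖x_i‖ ≤ δ, ‖y_i‖ ≤ δ, |z_i| ≤ δ for all 0 ≤ i ≤ k, one has x_k = R_x(x₀, y_k, z₀), y₀ = R_y(x₀, y_k, z₀), and z_k = z₀ + R_z(x₀, y_k, z₀); i.e. the orbit's end data (x_k, y₀, z_k) is a function of the cross data (x₀, y_k, z₀). (2) The functions and their first derivatives satisfy |R_x|, ‖DR_x‖ ≤ Cλ^k, |R_y|, ‖DR_y‖ ≤ Cλ^k, and |R_z|, ‖DR_z‖ ≤ Cλ^{k/2} uniformly on Q_δ, with C independent of k. -/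

import Mathlib

theorem Convex.inter_preimage_add_const {P : Type*} [AddCommGroup P] [Module ℝ P] {S : Set P}
    (hS : Convex ℝ S) (w : P) : Convex ℝ {q | q ∈ S ∧ q + w ∈ S} :=
  hS.inter (hS.translate_preimage_left w)

theorem HasFDerivWithinAt.add_const_sub {P F : Type*} [NormedAddCommGroup P] [NormedSpace ℝ P]
    [NormedAddCommGroup F] [NormedSpace ℝ F] {S : Set P} {φ : P → F} {L L' : P →L[ℝ] F} {q w : P}
    (hφ : HasFDerivWithinAt φ L S q) (hφ' : HasFDerivWithinAt φ L' S (q + w)) :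
    HasFDerivWithinAt (fun q => φ (q + w) - φ q) (L' - L) {q | q ∈ S ∧ q + w ∈ S} q := by
  refine HasFDerivWithinAt.sub ?_ (hφ.mono fun _ h => h.1)
  have h : HasFDerivWithinAt (fun q : P => q + w) (ContinuousLinearMap.id ℝ P)
      {q | q ∈ S ∧ q + w ∈ S} q := (hasFDerivWithinAt_id q _).add_const w
  simpa [Function.comp_def] using hφ'.comp q h fun _ h => h.2

theorem norm_second_difference_le {P F : Type*} [NormedAddCommGroup P] [NormedSpace ℝ P]
    [NormedAddCommGroup F] [NormedSpace ℝ F] {S : Set P} (hS : Convex ℝ S) {φ : P → F}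
    {φ' : P → P →L[ℝ] F} {K : ℝ} (hφ : ∀ q ∈ S, HasFDerivWithinAt φ (φ' q) S q)
    (hK : ∀ q ∈ S, ∀ q' ∈ S, ‖φ' q - φ' q'‖ ≤ K * ‖q - q'‖) {p v w : P} (hp : p ∈ S)
    (hv : p + v ∈ S) (hw : p + w ∈ S) (hvw : p + v + w ∈ S) :
    ‖φ (p + v + w) - φ (p + v) - (φ (p + w) - φ p)‖ ≤ K * ‖w‖ * ‖v‖ := by
  have h := (hS.inter_preimage_add_const w).norm_image_sub_le_of_norm_hasFDerivWithin_le
    (f := fun q => φ (q + w) - φ q) (f' := fun q => φ' (q + w) - φ' q) (C := K * ‖w‖)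
    (fun q hq => ?_) (fun q hq => ?_) ⟨hp, hw⟩ (y := p + v) ⟨hv, hvw⟩
  · simpa using h
  · exact (hφ q hq.1).add_const_sub (hφ (q + w) hq.2)
  · simpa using hK (q + w) hq.2 q hq.1

theorem norm_third_difference_le {P F : Type*} [NormedAddCommGroup P] [NormedSpace ℝ P]
    [NormedAddCommGroup F] [NormedSpace ℝ F] {S : Set P} (hS : Convex ℝ S) {φ : P → F}
    {φ' : P → P →L[ℝ] F} {φ'' : P → P →L[ℝ] P →L[ℝ] F} {K : ℝ}
    (hφ : ∀ q ∈ S, HasFDerivWithinAt φ (φ' q) S q)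
    (hφ' : ∀ q ∈ S, HasFDerivWithinAt φ' (φ'' q) S q)
    (hK : ∀ q ∈ S, ∀ q' ∈ S, ‖φ'' q - φ'' q'‖ ≤ K * ‖q - q'‖) {p u v w : P}
    (h0 : p ∈ S) (hu : p + u ∈ S) (hv : p + v ∈ S) (huv : p + u + v ∈ S)
    (hw : p + w ∈ S) (huw : p + u + w ∈ S) (hvw : p + v + w ∈ S) (huvw : p + u + v + w ∈ S) :
    ‖(φ (p + u + v + w) - φ (p + u + v)) - (φ (p + u + w) - φ (p + u))
      - ((φ (p + v + w) - φ (p + v)) - (φ (p + w) - φ p))‖ ≤ K * ‖w‖ * ‖v‖ * ‖u‖ := by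
  refine norm_second_difference_le (φ := fun q => φ (q + w) - φ q)
    (φ' := fun q => φ' (q + w) - φ' q) (K := K * ‖w‖)
    (hS.inter_preimage_add_const w) (fun q hq => ?_) (fun q hq q' hq' => ?_)
    ⟨h0, hw⟩ ⟨hu, huw⟩ ⟨hv, hvw⟩ ⟨huv, huvw⟩
  · exact (hφ q hq.1).add_const_sub (hφ (q + w) hq.2)
  · have h := norm_second_difference_le hS hφ' hK (p := q') (v := q - q') (w := w) hq'.1
      (by simpa using hq.1) hq'.2 (by simpa using hq.2)
    simpa using h

open Metric in
theorem exists_contDiffOn_inverse_id_sub {U : Type*} [NormedAddCommGroup U] [NormedSpace ℝ U]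
    [CompleteSpace U] {T : U → U} {ρ c : ℝ} (hρ : 0 < ρ) (hc0 : 0 ≤ c) (hc : c < 1)
    (hT0 : T 0 = 0) (hT : ContDiffOn ℝ 1 T (ball 0 ρ))
    (hL : ∀ u ∈ ball (0 : U) ρ, ∀ u' ∈ ball (0 : U) ρ, ‖T u - T u'‖ ≤ c * ‖u - u'‖) :
    ∃ Ψ : U → U, ContDiffOn ℝ 1 Ψ (ball 0 ((1 - c) * ρ)) ∧
      (∀ b ∈ ball (0 : U) ((1 - c) * ρ), Ψ b ∈ ball (0 : U) ρ) ∧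
      (∀ b ∈ ball (0 : U) ((1 - c) * ρ), ∀ b' ∈ ball (0 : U) ((1 - c) * ρ),
        ‖Ψ b - Ψ b'‖ ≤ (1 - c)⁻¹ * ‖b - b'‖) ∧
      ∀ u ∈ ball (0 : U) ρ, Ψ (u - T u) = u := by
  lift c to NNReal using hc0
  have hc' : c < 1 := by exact_mod_cast hc
  set I := ContinuousLinearEquiv.refl ℝ U with hI
  have happ : ApproximatesLinearOn (fun u => u - T u) (I : U →L[ℝ] U) (ball 0 ρ) c := by
    intro u hu u' hu'
    have : u - T u - (u' - T u') - (u - u') = -(T u - T u') := by abel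
    simpa [hI, this, norm_sub_rev] using hL u hu u' hu'
  have hsmall : Subsingleton U ∨ c < ‖(I.symm : U →L[ℝ] U)‖₊⁻¹ := by
    rcases subsingleton_or_nontrivial U with h | h
    · exact Or.inl h
    · right
      have : ‖(I.symm : U →L[ℝ] U)‖₊ = 1 := by
        ext; exact ContinuousLinearMap.norm_id
      simpa [this] using hc'
  set G := happ.toOpenPartialHomeomorph _ (ball 0 ρ) hsmall isOpen_ball with hG
  have hGs : G.source = ball 0 ρ := rfl
  have hinv : ∀ u ∈ ball (0 : U) ρ, ∀ u' ∈ ball (0 : U) ρ,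
      ‖u - u'‖ ≤ (1 - (c : ℝ))⁻¹ * ‖(u - T u) - (u' - T u')‖ := by
    intro u hu u' hu'
    rw [inv_mul_eq_div, le_div_iff₀ (by linarith)]
    have h1 := hL u hu u' hu'
    have h2 : ‖u - u'‖ ≤ ‖(u - T u) - (u' - T u')‖ + ‖T u - T u'‖ := by
      refine le_trans (le_of_eq ?_) (norm_add_le _ _)
      congr 1; abel
    nlinarith
  have hsub : ball (0 : U) ((1 - c) * ρ) ⊆ G.target := by
    intro b hb
    rw [mem_ball_zero_iff] at hb
    set ε := ‖b‖ / (1 - c) with hε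
    have hε0 : 0 ≤ ε := div_nonneg (norm_nonneg _) (by linarith)
    have hερ : ε < ρ := by
      rw [hε, div_lt_iff₀ (by linarith)]; linarith
    have hcb : closedBall (0 : U) ε ⊆ ball 0 ρ := closedBall_subset_ball hερ
    have hmaps : Set.MapsTo (fun u => b + T u) (closedBall (0 : U) ε) (closedBall (0 : U) ε) := by
      intro u hu
      have h1 := hL u (hcb hu) 0 (mem_ball_self hρ)
      rw [mem_closedBall_zero_iff] at hu ⊢
      rw [hT0, sub_zero, sub_zero] at h1
      have h2 : (c : ℝ) * ‖u‖ ≤ c * ε := by gcongr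
      have h3 : ε * (1 - c) = ‖b‖ := div_mul_cancel₀ _ (by linarith)
      exact (norm_add_le _ _).trans (by linarith)
    have hcontr : ContractingWith c (hmaps.restrict _ _ _) := by
      refine ⟨hc', LipschitzWith.of_dist_le_mul fun u u' => ?_⟩
      rw [Subtype.dist_eq, Subtype.dist_eq, dist_eq_norm, dist_eq_norm]
      simpa using hL u (hcb u.2) u' (hcb u'.2)
    obtain ⟨u, hu, hfix, -⟩ := hcontr.exists_fixedPoint' isClosed_closedBall.isComplete hmaps
      (mem_closedBall_self hε0) (edist_ne_top _ _)
    exact ⟨u, hcb hu, by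
      have : b + T u = u := hfix
      beta_reduce
      nth_rewrite 1 [← this]; abel⟩
  have hmem : ∀ b ∈ ball (0 : U) ((1 - c) * ρ), G.symm b ∈ ball (0 : U) ρ := fun b hb => by
    rw [← hGs]; exact G.map_target (hsub hb)
  have hright : ∀ b ∈ ball (0 : U) ((1 - c) * ρ), G.symm b - T (G.symm b) = b := fun b hb =>
    G.right_inv (hsub hb)
  refine ⟨G.symm, fun b hb => ?_, hmem, fun b hb b' hb' => ?_, fun u hu => ?_⟩
  · have hTa : ContDiffAt ℝ 1 T (G.symm b) :=
      hT.contDiffAt (isOpen_ball.mem_nhds (hmem b hb))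
    have hd := (hTa.differentiableAt one_ne_zero).hasFDerivAt
    have hn : ‖fderiv ℝ T (G.symm b)‖ < 1 := by
      refine lt_of_le_of_lt (norm_fderiv_le_of_lipschitzOn ℝ
        (isOpen_ball.mem_nhds (hmem b hb)) (C := c) ?_) hc
      exact LipschitzOnWith.of_dist_le_mul fun u hu u' hu' => by
        simpa [dist_eq_norm] using hL u hu u' hu'
    refine (G.contDiffAt_symm (f₀' := ContinuousLinearEquiv.unitsEquiv ℝ U
      (Units.oneSub (fderiv ℝ T (G.symm b)) hn)) (hsub hb) ?_ ?_).contDiffWithinAt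
    · exact (hasFDerivAt_id _).sub hd
    · exact contDiffAt_id.sub hTa
  · have h := hinv _ (hmem b hb) _ (hmem b' hb')
    rwa [hright b hb, hright b' hb'] at h
  · exact G.left_inv (x := u) hu

open Metric Filter Topology in
theorem ContDiffAt.exists_ball_hasFDerivWithinAt_lipschitz {P F : Type*} [NormedAddCommGroup P]
    [NormedSpace ℝ P] [NormedAddCommGroup F] [NormedSpace ℝ F] {H : P → F}
    (hH : ContDiffAt ℝ 2 H 0) :
    ∃ K r : ℝ, 0 ≤ K ∧ 0 < r ∧
      ∀ s ≤ r, (∀ q ∈ ball (0 : P) s, HasFDerivWithinAt H (fderiv ℝ H q) (ball 0 s) q) ∧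
      ∀ q ∈ ball (0 : P) s, ∀ q' ∈ ball (0 : P) s,
        ‖fderiv ℝ H q - fderiv ℝ H q'‖ ≤ K * ‖q - q'‖ := by
  obtain ⟨K, t, ht, hK⟩ :=
    (hH.fderiv_right (m := 1) (by norm_num)).exists_lipschitzOnWith
  have hd : ∀ᶠ q in 𝓝 (0 : P), DifferentiableAt ℝ H q :=
    (hH.eventually (by simp)).mono fun q hq => hq.differentiableAt two_ne_zero
  obtain ⟨r, hr, hball⟩ := eventually_nhds_iff_ball.1 (hd.and ht)
  refine ⟨K, r, K.2, hr, fun s hs => ⟨fun q hq => ?_, fun q hq q' hq' => ?_⟩⟩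
  · exact (hball q (ball_subset_ball hs hq)).1.hasFDerivAt.hasFDerivWithinAt
  · simpa [dist_eq_norm] using hK.dist_le_mul q (hball q (ball_subset_ball hs hq)).2 q'
      (hball q' (ball_subset_ball hs hq')).2

open Metric Filter Topology in
theorem exists_norm_sub_le_of_vanishing_on_ker {P F : Type*} [NormedAddCommGroup P]
    [NormedSpace ℝ P] [NormedAddCommGroup F] [NormedSpace ℝ F] {H : P → F}
    (hH : ContDiffAt ℝ 2 H 0) (π : P →L[ℝ] P) (hππ : ∀ p, π (π p) = π p)
    (hπ : ∀ p, ‖π p‖ ≤ ‖p‖) (hker : ∀ᶠ p in 𝓝 (0 : P), π p = 0 → H p = 0) {m : ℝ}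
    (hm : ‖(fderiv ℝ H 0).comp π‖ < m) :
    ∃ K r : ℝ, 0 ≤ K ∧ 0 < r ∧ ∀ p ∈ ball (0 : P) r, ∀ p' ∈ ball (0 : P) r,
      ‖H p - H p'‖ ≤ m * ‖π (p - p')‖ + K * ‖π p'‖ * ‖p - p'‖ := by
  obtain ⟨K, r₁, hK0, hr₁, hreg⟩ := hH.exists_ball_hasFDerivWithinAt_lipschitz
  have hcont : ContinuousAt (fun q => ‖(fderiv ℝ H q).comp π‖) 0 := by
    have h := (hH.fderiv_right (m := 1) (by norm_num)).continuousAt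
    exact (h.clm_comp continuousAt_const).norm
  obtain ⟨r₂, hr₂, hball⟩ := eventually_nhds_iff_ball.1 (hker.and (hcont.eventually_lt_const hm))
  set s := min r₁ r₂ with hs
  obtain ⟨hder, hlip⟩ := hreg s (min_le_left _ _)
  have hs0 : 0 < s := lt_min hr₁ hr₂
  refine ⟨K * 2, s / 3, by positivity, by positivity, fun p hp p' hp' => ?_⟩
  rw [mem_ball_zero_iff] at hp hp'
  have hd := hπ (p - p')
  have hd' := norm_sub_le p p'
  set v := π (p - p') with hv
  set w := p - v - p' with hw
  have hπv : π v = v := hππ _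
  have hπw : π w = 0 := by
    rw [hw, map_sub, map_sub, hπv, hv, map_sub]; abel
  have hp1 : p - v ∈ ball (0 : P) s := by
    rw [mem_ball_zero_iff]; linarith [norm_sub_le p v]
  have hps : p ∈ ball (0 : P) s := by rw [mem_ball_zero_iff]; linarith
  have hps' : p' ∈ ball (0 : P) s := by rw [mem_ball_zero_iff]; linarith
  have hq0 : p' - π p' ∈ ball (0 : P) s := by
    rw [mem_ball_zero_iff]; linarith [norm_sub_le p' (π p'), hπ p']
  have hq1' : p' - π p' + w ∈ ball (0 : P) s := by
    have : p' - π p' + w = p - π p := by rw [hw, hv, map_sub]; abel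
    rw [this, mem_ball_zero_iff]; linarith [norm_sub_le p (π p), hπ p]
  have h1 : ‖H p - H (p - v)‖ ≤ m * ‖v‖ := by
    have hsub : segment ℝ (p - v) p ⊆ ball (0 : P) s :=
      (convex_ball _ _).segment_subset hp1 hps
    have hline : ∀ t ∈ Set.Icc (0 : ℝ) 1, p - v + t • v ∈ ball (0 : P) s := fun t ht => by
      refine hsub ?_
      rw [segment_eq_image']
      exact ⟨t, ht, by simp⟩
    have h := (convex_Icc (0 : ℝ) 1).norm_image_sub_le_of_norm_hasDerivWithin_le
      (f := fun t : ℝ => H (p - v + t • v)) (f' := fun t => fderiv ℝ H (p - v + t • v) v)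
      (C := m * ‖v‖) (x := 0) (y := 1) (fun t ht => ?_) (fun t ht => ?_) (by simp) (by simp)
    · simpa using h
    · have h2 := ((hasDerivAt_id t).smul_const v).const_add (p - v)
      have h3 := ((hder _ (hline t ht)).hasFDerivAt
        (isOpen_ball.mem_nhds (hline t ht))).comp_hasDerivAt t h2
      simpa [Function.comp_def] using h3.hasDerivWithinAt
    · have h2 := (hball _ (ball_subset_ball (min_le_right _ _) (hline t ht))).2
      calc ‖fderiv ℝ H (p - v + t • v) v‖ = ‖((fderiv ℝ H (p - v + t • v)).comp π) v‖ := by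
            simp [hπv]
        _ ≤ _ := ContinuousLinearMap.le_of_opNorm_le _ h2.le _
  have h2 : ‖H (p - v) - H p'‖ ≤ K * ‖w‖ * ‖π p'‖ := by
    have h := norm_second_difference_le (convex_ball (0 : P) s) hder hlip
      (p := p' - π p') (v := π p') (w := w) hq0 (by simpa using hps') hq1'
      (by simpa [hw] using hp1)
    have e0 : H (p' - π p') = 0 :=
      (hball _ (ball_subset_ball (min_le_right _ _) hq0)).1 (by rw [map_sub, hππ, sub_self])
    have e1 : H (p' - π p' + w) = 0 :=
      (hball _ (ball_subset_ball (min_le_right _ _) hq1')).1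
        (by rw [map_add, map_sub, hππ, hπw]; simp)
    have e2 : p' - π p' + π p' + w = p - v := by rw [hw]; abel
    rw [e0, e1, e2] at h
    simpa using h
  have h3 : ‖w‖ ≤ 2 * ‖p - p'‖ := by
    have : w = (p - p') - v := by rw [hw]; abel
    rw [this]; linarith [norm_sub_le (p - p') v]
  calc ‖H p - H p'‖ ≤ ‖H p - H (p - v)‖ + ‖H (p - v) - H p'‖ :=
        norm_sub_le_norm_sub_add_norm_sub _ _ _
    _ ≤ m * ‖v‖ + K * (2 * ‖p - p'‖) * ‖π p'‖ := add_le_add h1 (h2.trans (by gcongr))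
    _ = _ := by ring

open Metric Filter Topology in
theorem exists_norm_sub_le_of_vanishing_on_axes {X : Type*} [NormedAddCommGroup X]
    [NormedSpace ℝ X] {g : X × X × ℝ → ℝ} (hg : ContDiffAt ℝ 3 g 0)
    (hvan : ∀ᶠ p in 𝓝 (0 : X × X × ℝ), p.1 = 0 ∨ p.2.1 = 0 → g p = 0) :
    ∃ K r : ℝ, 0 ≤ K ∧ 0 < r ∧ ∀ p ∈ ball (0 : X × X × ℝ) r, ∀ p' ∈ ball (0 : X × X × ℝ) r,
      ‖g p - g p'‖ ≤ K * (‖p.2.1‖ * ‖p.1 - p'.1‖ + ‖p'.1‖ * ‖p.2.1 - p'.2.1‖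
        + ‖p'.1‖ * ‖p'.2.1‖ * ‖p.2.2 - p'.2.2‖) := by
  obtain ⟨K₁, r₁, hK₁, hr₁, hreg₁⟩ :=
    (hg.of_le (m := 2) (by norm_num)).exists_ball_hasFDerivWithinAt_lipschitz
  obtain ⟨K₂, r₂, hK₂, hr₂, hreg₂⟩ :=
    (hg.fderiv_right (m := 2) (by norm_num)).exists_ball_hasFDerivWithinAt_lipschitz
  obtain ⟨r₃, hr₃, hball⟩ := eventually_nhds_iff_ball.1 hvan
  set s := min (min r₁ r₂) r₃ with hs
  have hs0 : 0 < s := lt_min (lt_min hr₁ hr₂) hr₃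
  obtain ⟨hder₁, hlip₁⟩ := hreg₁ s ((min_le_left _ _).trans (min_le_left _ _))
  obtain ⟨hder₂, hlip₂⟩ := hreg₂ s ((min_le_left _ _).trans (min_le_right _ _))
  have hz : ∀ q ∈ ball (0 : X × X × ℝ) s, q.1 = 0 ∨ q.2.1 = 0 → g q = 0 := fun q hq =>
    hball q (ball_subset_ball (min_le_right _ _) hq)
  have hmem : ∀ (x y : X) (z : ℝ), ‖x‖ < s → ‖y‖ < s → ‖z‖ < s →
      (x, y, z) ∈ ball (0 : X × X × ℝ) s := fun x y z hx hy hz => by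
    rw [mem_ball_zero_iff, Prod.norm_def, Prod.norm_def]; exact max_lt hx (max_lt hy hz)
  have h00 : ‖(0 : X)‖ < s := by simpa using hs0
  refine ⟨max K₁ K₂, s, le_max_of_le_left hK₁, hs0, ?_⟩
  rintro ⟨x, y, z⟩ hp ⟨x', y', z'⟩ hp'
  simp only [mem_ball_zero_iff, Prod.norm_def, max_lt_iff] at hp hp'
  obtain ⟨hx, hy, hz₀⟩ := hp
  obtain ⟨hx', hy', hz₀'⟩ := hp'
  have hC := convex_ball (0 : X × X × ℝ) s
  have e₁ : ‖g (x, y, z) - g (x', y, z)‖ ≤ K₁ * ‖x - x'‖ * ‖y‖ := by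
    have h := norm_second_difference_le hC hder₁ hlip₁ (p := (x', 0, z)) (v := (0, y, 0))
      (w := (x - x', 0, 0))
    simp only [Prod.mk_add_mk, add_zero, zero_add, add_sub_cancel] at h
    specialize h (hmem _ _ _ hx' h00 hz₀) (hmem _ _ _ hx' hy hz₀) (hmem _ _ _ hx h00 hz₀)
      (hmem _ _ _ hx hy hz₀)
    rw [hz (x, 0, z) (hmem _ _ _ hx h00 hz₀) (Or.inr rfl),
      hz (x', 0, z) (hmem _ _ _ hx' h00 hz₀) (Or.inr rfl)] at h
    simpa [Prod.norm_def] using h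
  have e₂ : ‖g (x', y, z) - g (x', y', z)‖ ≤ K₁ * ‖y - y'‖ * ‖x'‖ := by
    have h := norm_second_difference_le hC hder₁ hlip₁ (p := (0, y', z)) (v := (x', 0, 0))
      (w := (0, y - y', 0))
    simp only [Prod.mk_add_mk, add_zero, zero_add, add_sub_cancel] at h
    specialize h (hmem _ _ _ h00 hy' hz₀) (hmem _ _ _ hx' hy' hz₀) (hmem _ _ _ h00 hy hz₀)
      (hmem _ _ _ hx' hy hz₀)
    rw [hz (0, y, z) (hmem _ _ _ h00 hy hz₀) (Or.inl rfl),
      hz (0, y', z) (hmem _ _ _ h00 hy' hz₀) (Or.inl rfl)] at h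
    simpa [Prod.norm_def] using h
  have e₃ : ‖g (x', y', z) - g (x', y', z')‖ ≤ K₂ * ‖z - z'‖ * ‖y'‖ * ‖x'‖ := by
    have h := norm_third_difference_le hC hder₁ hder₂ hlip₂ (p := (0, 0, z')) (u := (x', 0, 0))
      (v := (0, y', 0)) (w := (0, 0, z - z'))
    simp only [Prod.mk_add_mk, add_zero, zero_add, add_sub_cancel] at h
    specialize h (hmem _ _ _ h00 h00 hz₀') (hmem _ _ _ hx' h00 hz₀') (hmem _ _ _ h00 hy' hz₀')
      (hmem _ _ _ hx' hy' hz₀') (hmem _ _ _ h00 h00 hz₀) (hmem _ _ _ hx' h00 hz₀)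
      (hmem _ _ _ h00 hy' hz₀) (hmem _ _ _ hx' hy' hz₀)
    rw [hz (0, 0, z) (hmem _ _ _ h00 h00 hz₀) (Or.inl rfl),
      hz (0, 0, z') (hmem _ _ _ h00 h00 hz₀') (Or.inl rfl),
      hz (x', 0, z) (hmem _ _ _ hx' h00 hz₀) (Or.inr rfl),
      hz (x', 0, z') (hmem _ _ _ hx' h00 hz₀') (Or.inr rfl),
      hz (0, y', z) (hmem _ _ _ h00 hy' hz₀) (Or.inl rfl),
      hz (0, y', z') (hmem _ _ _ h00 hy' hz₀') (Or.inl rfl)] at h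
    simpa [Prod.norm_def] using h
  calc ‖g (x, y, z) - g (x', y', z')‖
      ≤ ‖g (x, y, z) - g (x', y, z)‖ + ‖g (x', y, z) - g (x', y', z)‖
        + ‖g (x', y', z) - g (x', y', z')‖ := by
        refine le_trans (le_of_eq ?_) (norm_add₃_le)
        congr 1; abel
    _ ≤ max K₁ K₂ * ‖x - x'‖ * ‖y‖ + max K₁ K₂ * ‖y - y'‖ * ‖x'‖
        + max K₁ K₂ * ‖z - z'‖ * ‖y'‖ * ‖x'‖ := by
        gcongr
        · exact e₁.trans (by gcongr; exact le_max_left _ _)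
        · exact e₂.trans (by gcongr; exact le_max_left _ _)
        · exact e₃.trans (by gcongr; exact le_max_right _ _)
    _ = _ := by ring

/-- The orbit points `(x_i, y_i, z_i)` encoded by the rescaled coordinates
`x_i = λ^i X_i`, `y_i = λ^(k-i) Y_i`, `z_i = z₀ + λ^(k/2) W_i`. -/
noncomputable def rescaledPoint {X : Type*} [NormedAddCommGroup X] [NormedSpace ℝ X] (lam : ℝ)
    {k : ℕ} (u : (Fin (k + 1) → X × X × ℝ) × ℝ) (i : Fin (k + 1)) : X × X × ℝ :=
  (lam ^ (i : ℕ) • (u.1 i).1, lam ^ (k - i : ℕ) • (u.1 i).2.1,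
    u.2 + Real.sqrt lam ^ k * (u.1 i).2.2)

/-- The operator whose fixed points, up to the boundary data, are the orbit segments of length `k`
of the cross-form map `(x, η, z) ↦ (E p, F p η, z + g p)` in rescaled coordinates. -/
noncomputable def crossOperator {X : Type*} [NormedAddCommGroup X] [NormedSpace ℝ X] (lam : ℝ)
    (E : X × X × ℝ → X) (F : X × X × ℝ → X → X) (g : X × X × ℝ → ℝ) {k : ℕ}
    (u : (Fin (k + 1) → X × X × ℝ) × ℝ) : (Fin (k + 1) → X × X × ℝ) × ℝ :=
  (fun i =>
    (Fin.cases 0 (fun j : Fin k =>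
        (lam ^ (j + 1 : ℕ))⁻¹ • E (rescaledPoint lam u j.castSucc)) i,
      Fin.lastCases 0 (fun j : Fin k => (lam ^ (k - j : ℕ))⁻¹ •
        F (rescaledPoint lam u j.castSucc) (rescaledPoint lam u j.succ).2.1) i,
      (Real.sqrt lam ^ k)⁻¹ * ∑ j : Fin k,
        if j.castSucc < i then g (rescaledPoint lam u j.castSucc) else 0), 0)

/-- The boundary data `(x₀, y_k, z₀)` of an orbit segment of length `k`. -/
def crossBoundary {X : Type*} [Zero X] (k : ℕ) (q : X × X × ℝ) :
    (Fin (k + 1) → X × X × ℝ) × ℝ :=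
  (fun i => (Fin.cases q.1 (fun _ : Fin k => 0) i, Fin.lastCases q.2.1 (fun _ : Fin k => 0) i, 0),
    q.2.2)

theorem norm_crossBoundary_sub_le {X : Type*} [NormedAddCommGroup X] (k : ℕ) (q q' : X × X × ℝ) :
    ‖crossBoundary k q - crossBoundary k q'‖ ≤ ‖q - q'‖ := by
  rw [Prod.norm_def (crossBoundary k q - crossBoundary k q')]
  refine max_le ((pi_norm_le_iff_of_nonneg (norm_nonneg _)).2 fun i => ?_)
    ((norm_snd_le (q - q').2).trans (norm_snd_le _))
  have hx : ‖q.1 - q'.1‖ ≤ ‖q - q'‖ := norm_fst_le (q - q')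
  have hy : ‖q.2.1 - q'.2.1‖ ≤ ‖q - q'‖ := (norm_fst_le (q - q').2).trans (norm_snd_le _)
  rw [Prod.norm_def, Prod.norm_def]
  refine max_le ?_ (max_le ?_ (by simp [crossBoundary]))
  · cases i using Fin.cases <;> simp [crossBoundary, hx]
  · cases i using Fin.lastCases <;> simp [crossBoundary, hy]

section CrossOperator

variable {X : Type*} [NormedAddCommGroup X] [NormedSpace ℝ X]

open Metric

theorem norm_rescaledPoint_le {lam : ℝ} (h0 : 0 < lam) (h1 : lam < 1) {k : ℕ}
    (u : (Fin (k + 1) → X × X × ℝ) × ℝ) (i : Fin (k + 1)) :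
    ‖(rescaledPoint lam u i).1‖ ≤ lam ^ (i : ℕ) * ‖u‖ ∧
    ‖(rescaledPoint lam u i).2.1‖ ≤ lam ^ (k - i : ℕ) * ‖u‖ ∧
    ‖(rescaledPoint lam u i).2.2‖ ≤ 2 * ‖u‖ := by
  have hu : ‖u.1 i‖ ≤ ‖u‖ := (norm_le_pi_norm _ i).trans (norm_fst_le u)
  have hs : Real.sqrt lam ^ k ≤ 1 :=
    pow_le_one₀ (Real.sqrt_nonneg _) (Real.sqrt_le_one.2 h1.le)
  have hs0 : 0 ≤ Real.sqrt lam ^ k := pow_nonneg (Real.sqrt_nonneg _) _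
  refine ⟨?_, ?_, ?_⟩
  · simp only [rescaledPoint, norm_smul, norm_pow, Real.norm_of_nonneg h0.le]
    gcongr
    exact (norm_fst_le _).trans hu
  · simp only [rescaledPoint, norm_smul, norm_pow, Real.norm_of_nonneg h0.le]
    gcongr
    exact (norm_fst_le _).trans ((norm_snd_le _).trans hu)
  · have h2 : ‖(u.1 i).2.2‖ ≤ ‖u‖ := (norm_snd_le _).trans ((norm_snd_le _).trans hu)
    calc ‖u.2 + Real.sqrt lam ^ k * (u.1 i).2.2‖
        ≤ ‖u.2‖ + ‖Real.sqrt lam ^ k‖ * ‖(u.1 i).2.2‖ := by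
          rw [← norm_mul]; exact norm_add_le _ _
      _ ≤ ‖u‖ + 1 * ‖u‖ := by
          rw [Real.norm_of_nonneg hs0]
          gcongr
          exact norm_snd_le u
      _ = 2 * ‖u‖ := by ring

theorem rescaledPoint_sub (lam : ℝ) {k : ℕ} (u u' : (Fin (k + 1) → X × X × ℝ) × ℝ)
    (i : Fin (k + 1)) :
    rescaledPoint lam (u - u') i = rescaledPoint lam u i - rescaledPoint lam u' i := by
  simp only [rescaledPoint, Prod.fst_sub, Prod.snd_sub, Pi.sub_apply, smul_sub, Prod.mk_sub_mk]
  congr 2; ring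

theorem rescaledPoint_mem_ball {lam : ℝ} (h0 : 0 < lam) (h1 : lam < 1) {k : ℕ} {ρ : ℝ}
    {u : (Fin (k + 1) → X × X × ℝ) × ℝ} (hu : u ∈ ball 0 ρ) (i : Fin (k + 1)) :
    rescaledPoint lam u i ∈ ball 0 (2 * ρ) := by
  obtain ⟨hx, hy, hz⟩ := norm_rescaledPoint_le h0 h1 u i
  rw [mem_ball_zero_iff] at hu ⊢
  have e1 : lam ^ (i : ℕ) * ‖u‖ ≤ 1 * ‖u‖ := by gcongr; exact pow_le_one₀ h0.le h1.le
  have e2 : lam ^ (k - i : ℕ) * ‖u‖ ≤ 1 * ‖u‖ := by gcongr; exact pow_le_one₀ h0.le h1.le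
  have := norm_nonneg u
  rw [Prod.norm_def, Prod.norm_def]
  refine max_lt ?_ (max_lt ?_ ?_) <;> linarith

theorem contDiff_rescaledPoint (lam : ℝ) {k : ℕ} (i : Fin (k + 1)) :
    ContDiff ℝ 1 fun u : (Fin (k + 1) → X × X × ℝ) × ℝ => rescaledPoint lam u i := by
  unfold rescaledPoint
  fun_prop

theorem contDiff_crossBoundary (k : ℕ) :
    ContDiff ℝ 1 (crossBoundary k : X × X × ℝ → (Fin (k + 1) → X × X × ℝ) × ℝ) := by
  refine ContDiff.prodMk (contDiff_pi.2 fun i => ContDiff.prodMk ?_ (ContDiff.prodMk ?_ ?_)) ?_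
  · cases i using Fin.cases
    · simpa using contDiff_fst
    · simpa using contDiff_const
  · cases i using Fin.lastCases
    · simpa using contDiff_snd.fst
    · simpa using contDiff_const
  · exact contDiff_const
  · exact contDiff_snd.comp contDiff_snd

/-- Quantitative form, in rescaled coordinates, of the contraction properties of the map
`(x, η, z) ↦ (E p, F p η, z + g p)` near the curve of fixed points. -/
structure IsCrossContraction (E : X × X × ℝ → X) (F : X × X × ℝ → X → X) (g : X × X × ℝ → ℝ)
    (lam ρ c κ : ℝ) : Prop where
  contDiffOn_E : ContDiffOn ℝ 1 E (ball 0 (2 * ρ))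
  contDiffOn_F : ContDiffOn ℝ 1 (fun q : (X × X × ℝ) × X => F q.1 q.2)
    (ball 0 (2 * ρ) ×ˢ Set.univ)
  contDiffOn_g : ContDiffOn ℝ 1 g (ball 0 (2 * ρ))
  E_zero : E 0 = 0
  F_zero : F 0 0 = 0
  g_zero : ∀ z : ℝ, (0, 0, z) ∈ ball (0 : X × X × ℝ) (2 * ρ) → g (0, 0, z) = 0
  norm_E_sub_le : ∀ a d : ℝ, 0 ≤ a → a ≤ 1 → 0 ≤ d → ∀ p ∈ ball (0 : X × X × ℝ) (2 * ρ),
    ∀ p' ∈ ball (0 : X × X × ℝ) (2 * ρ), ‖p'.1‖ ≤ ρ * a → ‖p.1 - p'.1‖ ≤ a * d →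
    ‖p.2.1 - p'.2.1‖ ≤ d → ‖p.2.2 - p'.2.2‖ ≤ 2 * d → ‖E p - E p'‖ ≤ c * (lam * a * d)
  norm_F_sub_le : ∀ a d : ℝ, 0 ≤ a → a ≤ 1 → 0 ≤ d → ∀ p ∈ ball (0 : X × X × ℝ) (2 * ρ),
    ∀ p' ∈ ball (0 : X × X × ℝ) (2 * ρ), ∀ η η' : X, ‖p'.2.1‖ ≤ ρ * (lam * a) → ‖η'‖ ≤ ρ * a →
    ‖p.1 - p'.1‖ ≤ d → ‖p.2.1 - p'.2.1‖ ≤ lam * a * d → ‖p.2.2 - p'.2.2‖ ≤ 2 * d →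
    ‖η - η'‖ ≤ a * d → ‖F p η - F p' η'‖ ≤ c * (lam * a * d)
  norm_g_sub_le : ∀ a b d : ℝ, 0 ≤ a → a ≤ 1 → 0 ≤ b → b ≤ 1 → 0 ≤ d →
    ∀ p ∈ ball (0 : X × X × ℝ) (2 * ρ), ∀ p' ∈ ball (0 : X × X × ℝ) (2 * ρ),
    ‖p.2.1‖ ≤ ρ * b → ‖p'.1‖ ≤ ρ * a → ‖p'.2.1‖ ≤ ρ * b → ‖p.1 - p'.1‖ ≤ a * d →
    ‖p.2.1 - p'.2.1‖ ≤ b * d → ‖p.2.2 - p'.2.2‖ ≤ 2 * d → ‖g p - g p'‖ ≤ κ * (a * b * d)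
  mul_le : ∀ k : ℕ, k * Real.sqrt lam ^ k * κ ≤ c

variable {E : X × X × ℝ → X} {F : X × X × ℝ → X → X} {g : X × X × ℝ → ℝ} {lam ρ c κ : ℝ}

theorem IsCrossContraction.norm_inv_mul_sum_le (h : IsCrossContraction E F g lam ρ c κ)
    (h0 : 0 < lam) {k : ℕ} {d : ℝ} (hd : 0 ≤ d) (G : Fin k → ℝ)
    (hG : ∀ j, ‖G j‖ ≤ κ * (lam ^ k * d)) :
    ‖(Real.sqrt lam ^ k)⁻¹ * ∑ j : Fin k, G j‖ ≤ c * d := by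
  set s := Real.sqrt lam ^ k with hs
  have hs0 : 0 < s := pow_pos (Real.sqrt_pos.2 h0) _
  have hss : lam ^ k = s * s := by
    rw [hs, ← mul_pow, Real.mul_self_sqrt h0.le]
  have hsum : ‖∑ j : Fin k, G j‖ ≤ k * (κ * (lam ^ k * d)) := by
    simpa using norm_sum_le_of_le Finset.univ fun j _ => hG j
  rw [norm_mul, norm_inv, Real.norm_of_nonneg hs0.le]
  calc s⁻¹ * ‖∑ j : Fin k, G j‖ ≤ s⁻¹ * (k * (κ * (lam ^ k * d))) := by gcongr
    _ = (k * s * κ) * d := by rw [hss]; field_simp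
    _ ≤ c * d := by gcongr; exact h.mul_le k

theorem IsCrossContraction.norm_crossOperator_sub_le (h : IsCrossContraction E F g lam ρ c κ)
    (h0 : 0 < lam) (h1 : lam < 1) (hc : 0 ≤ c) (hκ : 0 ≤ κ) {k : ℕ}
    {u u' : (Fin (k + 1) → X × X × ℝ) × ℝ} (hu : u ∈ ball 0 ρ) (hu' : u' ∈ ball 0 ρ) :
    ‖crossOperator lam E F g u - crossOperator lam E F g u'‖ ≤ c * ‖u - u'‖ := by
  set d := ‖u - u'‖ with hd
  have hd0 : 0 ≤ d := norm_nonneg _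
  have hmem := fun i => rescaledPoint_mem_ball h0 h1 hu i
  have hmem' := fun i => rescaledPoint_mem_ball h0 h1 hu' i
  have hdiff := fun i => norm_rescaledPoint_le h0 h1 (u - u') i
  simp only [rescaledPoint_sub, Prod.fst_sub, Prod.snd_sub, ← hd] at hdiff
  have hle : ∀ v : (Fin (k + 1) → X × X × ℝ) × ℝ, v ∈ ball 0 ρ → ∀ i,
      ‖(rescaledPoint lam v i).1‖ ≤ ρ * lam ^ (i : ℕ) ∧
      ‖(rescaledPoint lam v i).2.1‖ ≤ ρ * lam ^ (k - i : ℕ) := by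
    intro v hv i
    obtain ⟨ha, hb, -⟩ := norm_rescaledPoint_le h0 h1 v i
    rw [mem_ball_zero_iff] at hv
    rw [mul_comm ρ, mul_comm ρ]
    exact ⟨ha.trans (by gcongr), hb.trans (by gcongr)⟩
  have hpow : ∀ m : ℕ, lam ^ m ≤ 1 := fun m => pow_le_one₀ h0.le h1.le
  have hpd : ∀ m : ℕ, lam ^ m * d ≤ d := fun m => mul_le_of_le_one_left hd0 (hpow m)
  rw [Prod.norm_def (crossOperator lam E F g u - _)]
  refine max_le ((pi_norm_le_iff_of_nonneg (by positivity)).2 fun i => ?_)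
    (by simpa [crossOperator] using by positivity)
  rw [Prod.norm_def, Prod.norm_def]
  refine max_le ?_ (max_le ?_ ?_)
  · cases i using Fin.cases with
    | zero => simpa [crossOperator] using by positivity
    | succ j =>
      have hE := h.norm_E_sub_le (lam ^ (j : ℕ)) d (by positivity) (hpow _) hd0 _
        (hmem j.castSucc) _ (hmem' j.castSucc) (hle u' hu' _).1 (hdiff _).1
        ((hdiff _).2.1.trans (hpd _)) (hdiff _).2.2
      simp only [crossOperator, Prod.fst_sub, Pi.sub_apply, Fin.cases_succ]
      rw [← smul_sub, norm_smul, norm_inv, norm_pow, Real.norm_of_nonneg h0.le,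
        inv_mul_le_iff₀ (by positivity)]
      exact hE.trans (le_of_eq (by ring))
  · cases i using Fin.lastCases with
    | last => simpa [crossOperator] using by positivity
    | cast j =>
      have hj : k - (j : ℕ) = (k - (j + 1 : ℕ)) + 1 := by omega
      have hj' : lam ^ (k - (j : ℕ)) = lam * lam ^ (k - (j + 1 : ℕ)) := by rw [hj, pow_succ']
      have hF := h.norm_F_sub_le (lam ^ (k - (j + 1 : ℕ))) d (by positivity) (hpow _) hd0 _
        (hmem j.castSucc) _ (hmem' j.castSucc) (rescaledPoint lam u j.succ).2.1
        (rescaledPoint lam u' j.succ).2.1 (by simpa [hj'] using (hle u' hu' j.castSucc).2)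
        (by simpa using (hle u' hu' j.succ).2)
        ((hdiff _).1.trans (hpd _)) (by simpa [hj'] using (hdiff j.castSucc).2.1)
        (hdiff _).2.2 (by simpa using (hdiff j.succ).2.1)
      simp only [crossOperator, Prod.fst_sub, Prod.snd_sub, Pi.sub_apply, Fin.lastCases_castSucc]
      rw [← smul_sub, norm_smul, norm_inv, norm_pow, Real.norm_of_nonneg h0.le,
        inv_mul_le_iff₀ (by positivity), hj']
      exact hF.trans (le_of_eq (by ring))
  · simp only [crossOperator, Prod.fst_sub, Prod.snd_sub, Pi.sub_apply]
    rw [← mul_sub, ← Finset.sum_sub_distrib]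
    refine h.norm_inv_mul_sum_le h0 hd0 _ fun j => ?_
    by_cases hji : j.castSucc < i
    · have hkj : lam ^ k = lam ^ (j : ℕ) * lam ^ (k - j : ℕ) := by
        rw [← pow_add]; congr 1; omega
      simp only [hji, if_true]
      rw [hkj]
      exact h.norm_g_sub_le (lam ^ (j : ℕ)) (lam ^ (k - j : ℕ)) d (by positivity) (hpow _)
        (by positivity) (hpow _) hd0 _ (hmem _) _ (hmem' _) (hle u hu j.castSucc).2
        (hle u' hu' j.castSucc).1 (hle u' hu' j.castSucc).2 (hdiff j.castSucc).1
        (hdiff j.castSucc).2.1 (hdiff _).2.2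
    · simpa [hji] using by positivity

theorem IsCrossContraction.contDiffOn_crossOperator (h : IsCrossContraction E F g lam ρ c κ)
    (h0 : 0 < lam) (h1 : lam < 1) {k : ℕ} :
    ContDiffOn ℝ 1 (crossOperator lam E F g (k := k)) (ball 0 ρ) := by
  have hmem : ∀ i, Set.MapsTo (fun u : (Fin (k + 1) → X × X × ℝ) × ℝ => rescaledPoint lam u i)
      (ball 0 ρ) (ball 0 (2 * ρ)) := fun i u hu => rescaledPoint_mem_ball h0 h1 hu i
  have hsm := fun i : Fin (k + 1) =>
    (contDiff_rescaledPoint (X := X) lam i).contDiffOn (s := ball 0 ρ)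
  refine ContDiffOn.prodMk (contDiffOn_pi.2 fun i => ContDiffOn.prodMk ?_
    (ContDiffOn.prodMk ?_ ?_)) contDiffOn_const
  · cases i using Fin.cases with
    | zero => simpa using contDiffOn_const
    | succ j =>
      simp only [Fin.cases_succ]
      exact (h.contDiffOn_E.comp (hsm j.castSucc) (hmem _)).const_smul _
  · cases i using Fin.lastCases with
    | last => simpa using contDiffOn_const
    | cast j =>
      simp only [Fin.lastCases_castSucc]
      exact (h.contDiffOn_F.comp ((hsm j.castSucc).prodMk (hsm j.succ).snd.fst)
        fun u hu => ⟨hmem _ hu, trivial⟩).const_smul _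
  · refine contDiffOn_const.mul (ContDiffOn.sum fun j _ => ?_)
    by_cases hji : j.castSucc < i
    · simp only [hji, if_true]
      exact h.contDiffOn_g.comp (hsm j.castSucc) (hmem _)
    · simpa [hji] using contDiffOn_const

theorem IsCrossContraction.crossOperator_zero (h : IsCrossContraction E F g lam ρ c κ)
    (hρ : 0 < ρ) {k : ℕ} : crossOperator lam E F g (k := k) 0 = 0 := by
  have hp : ∀ i : Fin (k + 1),
      rescaledPoint lam (0 : (Fin (k + 1) → X × X × ℝ) × ℝ) i = 0 := fun i => by
    simp [rescaledPoint]
  have hg : g 0 = 0 := h.g_zero 0 (mem_ball_self (by positivity))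
  refine Prod.ext (funext fun i => Prod.ext ?_ (Prod.ext ?_ ?_)) rfl
  · cases i using Fin.cases <;> simp [crossOperator, hp, h.E_zero]
  · cases i using Fin.lastCases <;> simp [crossOperator, hp, h.F_zero]
  · simp [crossOperator, hp, hg]

theorem sum_ite_lt_eq_sub_of_succ_eq_add {z a : ℕ → ℝ} {k : ℕ}
    (hz : ∀ i < k, z (i + 1) = z i + a i) (i : Fin (k + 1)) :
    ∑ j : Fin k, (if j.castSucc < i then a j else 0) = z i - z 0 := by
  have hfilter : (Finset.range k).filter (· < (i : ℕ)) = Finset.range i := by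
    ext j
    simp only [Finset.mem_filter, Finset.mem_range]
    omega
  calc ∑ j : Fin k, (if j.castSucc < i then a j else 0)
      = ∑ j ∈ Finset.range k, if j < (i : ℕ) then a j else 0 :=
        Fin.sum_univ_eq_sum_range (fun j => if j < (i : ℕ) then a j else 0) k
    _ = ∑ j ∈ Finset.range i, a j := by rw [← Finset.sum_filter, hfilter]
    _ = ∑ j ∈ Finset.range i, (z (j + 1) - z j) := by
        refine Finset.sum_congr rfl fun j hj => ?_
        rw [hz j (by have := Finset.mem_range.1 hj; omega)]; ring
    _ = z i - z 0 := Finset.sum_range_sub z i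

/-- An orbit segment of the cross-form map yields, in rescaled coordinates, a solution of the
equation `u - T u = b`. -/
theorem IsCrossContraction.exists_sub_crossOperator_eq (h : IsCrossContraction E F g lam ρ c κ)
    (h0 : 0 < lam) (h1 : lam < 1) (hρ : 0 < ρ) (hc1 : c ≤ 1) (hκ : 0 ≤ κ) {k : ℕ} {δ : ℝ}
    (hδ : 0 ≤ δ) (hδρ : δ < ρ) {p : ℕ → X × X × ℝ}
    (hp : ∀ i < k, (p (i + 1)).1 = E (p i) ∧ (p i).2.1 = F (p i) (p (i + 1)).2.1 ∧
      (p (i + 1)).2.2 = (p i).2.2 + g (p i))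
    (hle : ∀ i ≤ k, ‖(p i).1‖ ≤ lam ^ i * δ ∧ ‖(p i).2.1‖ ≤ lam ^ (k - i) * δ ∧
      |(p i).2.2| ≤ δ) :
    ∃ u : (Fin (k + 1) → X × X × ℝ) × ℝ, ‖u‖ ≤ δ ∧
      u - crossOperator lam E F g u = crossBoundary k ((p 0).1, (p k).2.1, (p 0).2.2) ∧
      ∀ i, rescaledPoint lam u i = p i := by
  have hs0 : 0 < Real.sqrt lam ^ k := pow_pos (Real.sqrt_pos.2 h0) _
  set u : (Fin (k + 1) → X × X × ℝ) × ℝ := (fun i => ((lam ^ (i : ℕ))⁻¹ • (p i).1,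
    (lam ^ (k - i : ℕ))⁻¹ • (p i).2.1, (Real.sqrt lam ^ k)⁻¹ * ((p i).2.2 - (p 0).2.2)),
    (p 0).2.2) with hu
  have hres : ∀ i, rescaledPoint lam u i = p i := fun i => by
    refine Prod.ext ?_ (Prod.ext ?_ ?_)
    · exact smul_inv_smul₀ (pow_pos h0 _).ne' _
    · exact smul_inv_smul₀ (pow_pos h0 _).ne' _
    · simp only [rescaledPoint, hu]
      rw [mul_inv_cancel_left₀ hs0.ne']; ring
  have hsum := sum_ite_lt_eq_sub_of_succ_eq_add (z := fun i => (p i).2.2)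
    (a := fun i => g (p i)) fun i hi => (hp i hi).2.2
  have hball : ∀ i ≤ k, ∀ x y : X, ‖x‖ ≤ δ → ‖y‖ ≤ δ →
      (x, y, (p i).2.2) ∈ ball (0 : X × X × ℝ) (2 * ρ) := fun i hi x y hx hy => by
    rw [mem_ball_zero_iff, Prod.norm_def, Prod.norm_def, max_lt_iff, max_lt_iff]
    have := (hle i hi).2.2
    rw [Real.norm_eq_abs]
    exact ⟨by linarith, by linarith, by linarith⟩
  have hpd : ∀ m : ℕ, lam ^ m * δ ≤ δ := fun m =>
    mul_le_of_le_one_left hδ (pow_le_one₀ h0.le h1.le)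
  refine ⟨u, ?_, ?_, hres⟩
  · rw [Prod.norm_def]
    refine max_le ((pi_norm_le_iff_of_nonneg hδ).2 fun i => ?_) (hle 0 (Nat.zero_le _)).2.2
    have hik : (i : ℕ) ≤ k := Nat.lt_succ_iff.1 i.2
    obtain ⟨hx, hy, hz⟩ := hle i hik
    rw [Prod.norm_def, Prod.norm_def]
    refine max_le ?_ (max_le ?_ ?_)
    · simp only [hu]
      rwa [norm_smul, norm_inv, norm_pow, Real.norm_of_nonneg h0.le,
        inv_mul_le_iff₀ (by positivity)]
    · simp only [hu]
      rwa [norm_smul, norm_inv, norm_pow, Real.norm_of_nonneg h0.le,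
        inv_mul_le_iff₀ (by positivity)]
    · simp only [hu]
      rw [← hsum]
      refine (h.norm_inv_mul_sum_le h0 hδ _ fun j => ?_).trans (mul_le_of_le_one_left hδ hc1)
      by_cases hji : j.castSucc < i
      · have hkj : lam ^ k = lam ^ (j : ℕ) * lam ^ (k - j : ℕ) := by
          rw [← pow_add]; congr 1; omega
        have hjk : (j : ℕ) ≤ k := j.2.le
        obtain ⟨hx, hy, hz⟩ := hle j hjk
        have hpj := hball j hjk (p j).1 (p j).2.1 (hx.trans (hpd _)) (hy.trans (hpd _))
        have h00 := hball j hjk 0 0 (by simpa) (by simpa)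
        have hg := h.norm_g_sub_le (lam ^ (j : ℕ)) (lam ^ (k - j : ℕ)) δ (by positivity)
          (pow_le_one₀ h0.le h1.le) (by positivity) (pow_le_one₀ h0.le h1.le) hδ _ hpj _ h00
          (hy.trans (by rw [mul_comm]; gcongr))
          (by simpa using by positivity) (by simpa using by positivity)
          (by simpa using hx) (by simpa using hy) (by simpa using hδ)
        rw [h.g_zero _ h00, sub_zero] at hg
        simpa only [hji, if_true, hkj] using hg
      · simpa [hji] using by positivity
  · refine Prod.ext (funext fun i => Prod.ext ?_ (Prod.ext ?_ ?_))
      (by simp [hu, crossOperator, crossBoundary])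
    · cases i using Fin.cases with
      | zero => simp [hu, crossOperator, crossBoundary]
      | succ j =>
        simp only [crossOperator, crossBoundary, Prod.fst_sub, Pi.sub_apply, Fin.cases_succ, hres]
        simp [hu, (hp j j.2).1]
    · cases i using Fin.lastCases with
      | last => simp [hu, crossOperator, crossBoundary]
      | cast j =>
        simp only [crossOperator, crossBoundary, Prod.fst_sub, Prod.snd_sub, Pi.sub_apply,
          Fin.lastCases_castSucc, hres]
        simp [hu, ← (hp j j.2).2.1]
    · simp only [crossOperator, crossBoundary, Prod.fst_sub, Prod.snd_sub, Pi.sub_apply, hres]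
      simp only [Fin.val_castSucc, hsum]
      simp [hu]

theorem IsCrossContraction.exists_cross_map [CompleteSpace X]
    (h : IsCrossContraction E F g lam ρ c κ) (h0 : 0 < lam) (h1 : lam < 1) (hρ : 0 < ρ)
    (hc : 0 ≤ c) (hc1 : c < 1) (hκ : 0 ≤ κ) (k : ℕ) :
    ∃ S : X × X × ℝ → X × X × ℝ, ContDiffOn ℝ 1 S (ball 0 ((1 - c) * ρ)) ∧
      (∀ q ∈ ball (0 : X × X × ℝ) ((1 - c) * ρ), ∀ q' ∈ ball (0 : X × X × ℝ) ((1 - c) * ρ),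
        ‖S q - S q'‖ ≤ (1 - c)⁻¹ * ‖q - q'‖) ∧
      (∀ q ∈ ball (0 : X × X × ℝ) ((1 - c) * ρ), ‖S q‖ ≤ ρ) ∧
      ∀ δ : ℝ, 0 ≤ δ → δ < (1 - c) * ρ → ∀ p : ℕ → X × X × ℝ,
        (∀ i < k, (p (i + 1)).1 = E (p i) ∧ (p i).2.1 = F (p i) (p (i + 1)).2.1 ∧
          (p (i + 1)).2.2 = (p i).2.2 + g (p i)) →
        (∀ i ≤ k, ‖(p i).1‖ ≤ lam ^ i * δ ∧ ‖(p i).2.1‖ ≤ lam ^ (k - i) * δ ∧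
          |(p i).2.2| ≤ δ) →
        (p k).1 = lam ^ k • (S ((p 0).1, (p k).2.1, (p 0).2.2)).1 ∧
        (p 0).2.1 = lam ^ k • (S ((p 0).1, (p k).2.1, (p 0).2.2)).2.1 ∧
        (p k).2.2 = (p 0).2.2 +
          Real.sqrt lam ^ k * (S ((p 0).1, (p k).2.1, (p 0).2.2)).2.2 := by
  obtain ⟨Ψ, hΨ, hmem, hlip, hsol⟩ := exists_contDiffOn_inverse_id_sub hρ hc hc1
    (h.crossOperator_zero hρ (k := k)) (h.contDiffOn_crossOperator h0 h1)
    fun u hu u' hu' => h.norm_crossOperator_sub_le h0 h1 hc hκ hu hu'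
  have hb : Set.MapsTo (crossBoundary k) (ball (0 : X × X × ℝ) ((1 - c) * ρ))
      (ball 0 ((1 - c) * ρ)) := fun q hq => by
    rw [mem_ball_zero_iff] at hq ⊢
    have hb0 : crossBoundary k (0 : X × X × ℝ) = 0 := by
      refine Prod.ext (funext fun i => Prod.ext ?_ (Prod.ext ?_ rfl)) rfl
      · cases i using Fin.cases <;> simp [crossBoundary]
      · cases i using Fin.lastCases <;> simp [crossBoundary]
    have hq' := norm_crossBoundary_sub_le k q 0
    rw [hb0, sub_zero, sub_zero] at hq'
    exact hq'.trans_lt hq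
  have hread : ∀ v : (Fin (k + 1) → X × X × ℝ) × ℝ,
      ‖((v.1 (Fin.last k)).1, (v.1 0).2.1, (v.1 (Fin.last k)).2.2)‖ ≤ ‖v‖ := fun v => by
    have hi : ∀ i, ‖v.1 i‖ ≤ ‖v‖ := fun i => (norm_le_pi_norm _ i).trans (norm_fst_le v)
    rw [Prod.norm_def, Prod.norm_def]
    exact max_le ((norm_fst_le (v.1 (Fin.last k))).trans (hi _)) (max_le
      ((norm_fst_le (v.1 0).2).trans ((norm_snd_le _).trans (hi _)))
      ((norm_snd_le (v.1 (Fin.last k)).2).trans ((norm_snd_le _).trans (hi _))))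
  refine ⟨fun q => (((Ψ (crossBoundary k q)).1 (Fin.last k)).1, ((Ψ (crossBoundary k q)).1 0).2.1,
    ((Ψ (crossBoundary k q)).1 (Fin.last k)).2.2), ?_, fun q hq q' hq' => ?_, fun q hq => ?_,
    fun δ hδ hδρ p hp hle => ?_⟩
  · have hcomp := hΨ.comp (contDiff_crossBoundary k).contDiffOn hb
    have hread' : ContDiff ℝ 1 fun v : (Fin (k + 1) → X × X × ℝ) × ℝ =>
        ((v.1 (Fin.last k)).1, (v.1 0).2.1, (v.1 (Fin.last k)).2.2) := by fun_prop
    exact hread'.comp_contDiffOn hcomp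
  · refine (hread (Ψ (crossBoundary k q) - Ψ (crossBoundary k q'))).trans
      ((hlip _ (hb hq) _ (hb hq')).trans ?_)
    have := sub_pos.2 hc1
    gcongr
    exact norm_crossBoundary_sub_le k q q'
  · exact (hread _).trans (mem_ball_zero_iff.1 (hmem _ (hb hq))).le
  · have hδρ' : δ < ρ := hδρ.trans_le (mul_le_of_le_one_left hρ.le (by linarith))
    obtain ⟨u, hu, heq, hres⟩ :=
      h.exists_sub_crossOperator_eq h0 h1 hρ hc1.le hκ hδ hδρ' hp hle
    have hΨu : Ψ (crossBoundary k ((p 0).1, (p k).2.1, (p 0).2.2)) = u := by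
      rw [← heq]
      exact hsol u (mem_ball_zero_iff.2 (hu.trans_lt hδρ'))
    have hlast := hres (Fin.last k)
    have hzero := hres 0
    have hu2 : u.2 = (p 0).2.2 := by
      have := congrArg Prod.snd heq
      simpa [crossOperator, crossBoundary] using this
    simp only [hΨu]
    refine ⟨?_, ?_, ?_⟩
    · simpa [rescaledPoint] using (congrArg Prod.fst hlast).symm
    · simpa [rescaledPoint] using (congrArg (fun q => q.2.1) hzero).symm
    · simpa [rescaledPoint, hu2] using (congrArg (fun q => q.2.2) hlast).symm

end CrossOperator

section NearFixedCurve

variable {X : Type*} [NormedAddCommGroup X] [NormedSpace ℝ X]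

open Metric Filter Topology

theorem exists_norm_contraction_add_remainder_sub_le {A : ℝ → X →L[ℝ] X} (hA : ContDiff ℝ 2 A)
    {e : X × X × ℝ → X} (he : ContDiffAt ℝ 2 e 0)
    (he0 : ∀ᶠ p in 𝓝 (0 : X × X × ℝ), p.1 = 0 → e p = 0)
    (heD : fderiv ℝ (fun x : X => e (x, 0, 0)) 0 = 0) {m : ℝ} (hm : ‖A 0‖ < m) :
    ∃ K r : ℝ, 0 ≤ K ∧ 0 < r ∧ ∀ p ∈ ball (0 : X × X × ℝ) r, ∀ p' ∈ ball (0 : X × X × ℝ) r,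
      ‖(A p.2.2 p.1 + e p) - (A p'.2.2 p'.1 + e p')‖
        ≤ m * ‖p.1 - p'.1‖ + K * ‖p'.1‖ * ‖p - p'‖ := by
  set ι : X →L[ℝ] X × X × ℝ := ContinuousLinearMap.inl ℝ X (X × ℝ) with hι
  set π : (X × X × ℝ) →L[ℝ] X × X × ℝ := ι.comp (ContinuousLinearMap.fst ℝ X (X × ℝ)) with hπ
  have hE : ContDiffAt ℝ 2 (fun p : X × X × ℝ => A p.2.2 p.1 + e p) 0 := by
    refine ContDiffAt.add ?_ he
    exact ((hA.comp contDiff_snd.snd).clm_apply contDiff_fst).contDiffAt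
  have hnorm : ∀ x : X, ‖ι x‖ = ‖x‖ := fun x => by simp [hι, Prod.norm_def]
  have hfderiv : (fderiv ℝ (fun p : X × X × ℝ => A p.2.2 p.1 + e p) 0).comp ι = A 0 := by
    have h1 : HasFDerivAt (fun x : X => A 0 x + e (x, 0, 0))
        ((fderiv ℝ (fun p : X × X × ℝ => A p.2.2 p.1 + e p) 0).comp ι) 0 :=
      HasFDerivAt.comp (g := fun p : X × X × ℝ => A p.2.2 p.1 + e p) (f := ι) 0
        (by simpa using (hE.differentiableAt two_ne_zero).hasFDerivAt) ι.hasFDerivAt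
    have h2 : DifferentiableAt ℝ (fun x : X => e (x, 0, 0)) 0 :=
      DifferentiableAt.comp (g := e) (f := ι) 0
        (by simpa using he.differentiableAt two_ne_zero) ι.differentiableAt
    have h3 := (A 0).hasFDerivAt.add h2.hasFDerivAt
    rw [heD, add_zero] at h3
    exact h1.unique h3
  obtain ⟨K, r, hK, hr, h⟩ := exists_norm_sub_le_of_vanishing_on_ker hE π
    (fun p => by simp [hπ, hι])
    (fun p => by rw [hπ, ContinuousLinearMap.comp_apply, hnorm]; exact norm_fst_le p)
    (he0.mono fun p hp hp' => by
      have hx : p.1 = 0 := by simpa [hπ, hι] using congrArg Prod.fst hp'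
      simp [hx, hp hx]) (m := m) (by
      rw [hπ, ← ContinuousLinearMap.comp_assoc, hfderiv]
      refine lt_of_le_of_lt ((ContinuousLinearMap.opNorm_comp_le _ _).trans ?_) hm
      exact mul_le_of_le_one_right (norm_nonneg _) (ContinuousLinearMap.norm_fst_le ℝ X (X × ℝ)))
  refine ⟨K, r, hK, hr, fun p hp p' hp' => ?_⟩
  have := h p hp p' hp'
  rwa [hπ, ContinuousLinearMap.comp_apply, ContinuousLinearMap.comp_apply, hnorm, hnorm] at this

theorem exists_norm_inverse_expansion_sub_le {A : ℝ → X →L[ℝ] X} (hA : ContDiff ℝ 2 A)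
    {lam0 r₀ : ℝ} (hr₀ : 0 < r₀) (hAnorm : ∀ z : ℝ, |z| ≤ r₀ → ‖A z‖ ≤ lam0)
    {f : X × X × ℝ → X} (hf : ContDiffAt ℝ 2 f 0)
    (hf0 : ∀ᶠ p in 𝓝 (0 : X × X × ℝ), p.2.1 = 0 → f p = 0)
    (hfD : fderiv ℝ (fun y : X => f (0, y, 0)) 0 = 0) {ε : ℝ} (hε : 0 < ε) :
    ∃ K r : ℝ, 0 ≤ K ∧ 0 < r ∧ ∀ p ∈ ball (0 : X × X × ℝ) r, ∀ p' ∈ ball (0 : X × X × ℝ) r,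
      ∀ η η' : X, ‖A p.2.2 (η - f p) - A p'.2.2 (η' - f p')‖
        ≤ lam0 * ‖η - η'‖ + K * ‖η'‖ * ‖p - p'‖ + ε * ‖p.2.1 - p'.2.1‖
          + K * ‖p'.2.1‖ * ‖p - p'‖ := by
  set ι : X →L[ℝ] X × X × ℝ :=
    (ContinuousLinearMap.inr ℝ X (X × ℝ)).comp (ContinuousLinearMap.inl ℝ X ℝ) with hι
  set π : (X × X × ℝ) →L[ℝ] X × X × ℝ := ι.comp
    ((ContinuousLinearMap.fst ℝ X ℝ).comp (ContinuousLinearMap.snd ℝ X (X × ℝ))) with hπ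
  have hE : ContDiffAt ℝ 2 (fun p : X × X × ℝ => A p.2.2 (f p)) 0 :=
    (hA.comp contDiff_snd.snd).contDiffAt.clm_apply hf
  have hnorm : ∀ x : X, ‖ι x‖ = ‖x‖ := fun x => by simp [hι, Prod.norm_def]
  have hfderiv : (fderiv ℝ (fun p : X × X × ℝ => A p.2.2 (f p)) 0).comp ι = 0 := by
    have h1 : HasFDerivAt (fun y : X => A 0 (f (0, y, 0)))
        ((fderiv ℝ (fun p : X × X × ℝ => A p.2.2 (f p)) 0).comp ι) 0 :=
      HasFDerivAt.comp (g := fun p : X × X × ℝ => A p.2.2 (f p)) (f := ι) 0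
        (by simpa using (hE.differentiableAt two_ne_zero).hasFDerivAt) ι.hasFDerivAt
    have h2 : DifferentiableAt ℝ (fun y : X => f (0, y, 0)) 0 :=
      DifferentiableAt.comp (g := f) (f := ι) 0
        (by simpa using hf.differentiableAt two_ne_zero) ι.differentiableAt
    have h3 := (A 0).hasFDerivAt.comp 0 h2.hasFDerivAt
    rw [hfD, ContinuousLinearMap.comp_zero] at h3
    exact h1.unique h3
  obtain ⟨K₁, r₁, hK₁, hr₁, h₁⟩ := exists_norm_sub_le_of_vanishing_on_ker hE π
    (fun p => by simp [hπ, hι])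
    (fun p => by
      rw [hπ, ContinuousLinearMap.comp_apply, hnorm]
      exact (norm_fst_le p.2).trans (norm_snd_le p))
    (hf0.mono fun p hp hp' => by
      have hy : p.2.1 = 0 := by simpa [hπ, hι] using congrArg (fun q => q.2.1) hp'
      simp [hp hy]) (m := ε) (by
      rw [hπ, ← ContinuousLinearMap.comp_assoc, hfderiv]
      simpa using hε)
  obtain ⟨K₂, t, ht, hK₂⟩ :=
    ((hA.of_le (m := 1) (by norm_num)).contDiffAt (x := 0)).exists_lipschitzOnWith
  obtain ⟨r₂, hr₂, ht'⟩ := Metric.mem_nhds_iff.1 ht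
  refine ⟨max K₁ K₂, min r₁ (min r₂ r₀), le_max_of_le_left hK₁, by positivity, ?_⟩
  intro p hp p' hp' η η'
  have hzle : ∀ q : X × X × ℝ, |q.2.2| ≤ ‖q‖ := fun q => (norm_snd_le q.2).trans (norm_snd_le q)
  have hz : ∀ q ∈ ball (0 : X × X × ℝ) (min r₁ (min r₂ r₀)), q.2.2 ∈ t ∧ ‖A q.2.2‖ ≤ lam0 := by
    intro q hq
    rw [mem_ball_zero_iff, lt_min_iff, lt_min_iff] at hq
    exact ⟨ht' (by rw [mem_ball_zero_iff]; exact (hzle q).trans_lt hq.2.1),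
      hAnorm _ ((hzle q).trans hq.2.2.le)⟩
  have e₁ := h₁ p (ball_subset_ball (min_le_left _ _) hp) p'
    (ball_subset_ball (min_le_left _ _) hp')
  have hπn : ∀ q, ‖π q‖ = ‖q.2.1‖ := fun q => hnorm q.2.1
  rw [hπn, hπn] at e₁
  have e₂ : ‖A p.2.2 - A p'.2.2‖ ≤ K₂ * ‖p - p'‖ := by
    have h := hK₂.dist_le_mul _ (hz p hp).1 _ (hz p' hp').1
    rw [dist_eq_norm, dist_eq_norm] at h
    exact h.trans (by gcongr; exact hzle (p - p'))
  calc ‖A p.2.2 (η - f p) - A p'.2.2 (η' - f p')‖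
      = ‖A p.2.2 (η - η') + (A p.2.2 - A p'.2.2) η' - (A p.2.2 (f p) - A p'.2.2 (f p'))‖ := by
        simp only [map_sub, sub_apply]
        congr 1; abel
    _ ≤ ‖A p.2.2 (η - η')‖ + ‖(A p.2.2 - A p'.2.2) η'‖ + ‖A p.2.2 (f p) - A p'.2.2 (f p')‖ :=
        (norm_sub_le _ _).trans (by gcongr; exact norm_add_le _ _)
    _ ≤ lam0 * ‖η - η'‖ + max K₁ K₂ * ‖p - p'‖ * ‖η'‖
        + (ε * ‖p.2.1 - p'.2.1‖ + max K₁ K₂ * ‖p'.2.1‖ * ‖p - p'‖) := by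
        gcongr ?_ + ?_ + ?_
        · exact ContinuousLinearMap.le_of_opNorm_le _ (hz p hp).2 _
        · exact ContinuousLinearMap.le_of_opNorm_le _
            (e₂.trans (by gcongr; exact le_max_right _ _)) _
        · exact e₁.trans (by gcongr; exacts [le_rfl, le_max_left _ _])
    _ = _ := by ring

theorem exists_nat_mul_sqrt_pow_le {lam : ℝ} (h1 : lam < 1) :
    ∃ M : ℝ, 0 ≤ M ∧ ∀ k : ℕ, k * Real.sqrt lam ^ k ≤ M := by
  obtain ⟨M, hM⟩ := (tendsto_self_mul_const_pow_of_lt_one (Real.sqrt_nonneg lam)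
    ((Real.sqrt_lt_sqrt_iff_of_pos one_pos).2 h1 |>.trans_eq Real.sqrt_one)).bddAbove_range
  have hM' : ∀ k : ℕ, k * Real.sqrt lam ^ k ≤ M := fun k => hM ⟨k, rfl⟩
  exact ⟨M, by simpa using hM' 0, hM'⟩

theorem exists_isCrossContraction {A : ℝ → X →L[ℝ] X} (hA : ContDiff ℝ 2 A) {lam0 r₀ : ℝ}
    (hlam0 : lam0 < 1) (hr₀ : 0 < r₀) (hAnorm : ∀ z : ℝ, |z| ≤ r₀ → ‖A z‖ ≤ lam0)
    {V : Set (X × X × ℝ)} (hV : V ∈ 𝓝 0) {e f : X × X × ℝ → X} {g : X × X × ℝ → ℝ}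
    (he : ContDiffOn ℝ 2 e V) (hf : ContDiffOn ℝ 2 f V) (hg : ContDiffOn ℝ 3 g V)
    (he0 : ∀ p ∈ V, p.1 = 0 → e p = 0) (heD : fderiv ℝ (fun x : X => e (x, 0, 0)) 0 = 0)
    (hf0 : ∀ p ∈ V, p.2.1 = 0 → f p = 0) (hfD : fderiv ℝ (fun y : X => f (0, y, 0)) 0 = 0)
    (hg0 : ∀ p ∈ V, p.1 = 0 ∨ p.2.1 = 0 → g p = 0) :
    ∃ lam ρ c κ : ℝ, 0 < lam ∧ lam < 1 ∧ 0 < ρ ∧ 0 ≤ c ∧ c < 1 ∧ 0 ≤ κ ∧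
      ball 0 (2 * ρ) ⊆ V ∧
      IsCrossContraction (fun p => A p.2.2 p.1 + e p) (fun p η => A p.2.2 (η - f p)) g lam ρ c κ ∧
      (∀ p ∈ ball (0 : X × X × ℝ) (2 * ρ), ‖A p.2.2 p.1 + e p‖ ≤ lam * ‖p.1‖) ∧
      ∀ p ∈ ball (0 : X × X × ℝ) (2 * ρ), ∀ η : X, p.2.1 = A p.2.2 (η - f p) →
        ‖p.2.1‖ ≤ lam * ‖η‖ := by
  have hA0 : ‖A 0‖ ≤ lam0 := hAnorm 0 (by simpa using hr₀.le)
  have hlam0' : 0 ≤ lam0 := (norm_nonneg _).trans hA0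
  set τ := (1 - lam0) / 8 with hτ
  have hτ0 : 0 < τ := by rw [hτ]; linarith
  obtain ⟨lam, hlam⟩ : ∃ lam, lam = lam0 + 4 * τ := ⟨_, rfl⟩
  have hl0 : 0 < lam := by linarith
  have hl1 : lam < 1 := by rw [hlam, hτ]; linarith
  obtain ⟨M, hM0, hM⟩ := exists_nat_mul_sqrt_pow_le hl1
  obtain ⟨K₁, r₁, hK₁, hr₁, h₁⟩ := exists_norm_contraction_add_remainder_sub_le hA
    (he.contDiffAt hV) (eventually_of_mem hV he0) heD (m := lam0 + 2 * τ) (by linarith)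
  obtain ⟨K₂, r₂, hK₂, hr₂, h₂⟩ := exists_norm_inverse_expansion_sub_le hA hr₀ hAnorm
    (hf.contDiffAt hV) (eventually_of_mem hV hf0) hfD (ε := 2 * τ) (by linarith)
  obtain ⟨K₃, r₃, hK₃, hr₃, h₃⟩ := exists_norm_sub_le_of_vanishing_on_axes
    (hg.contDiffAt hV) (eventually_of_mem hV hg0)
  obtain ⟨r₄, hr₄, hV'⟩ := Metric.mem_nhds_iff.1 hV
  obtain ⟨ρ, hρ0, hρ1, hρr₁, hρr₂, hρr₃, hρr₄, hρK₁, hρK₂, hρK₃⟩ : ∃ ρ : ℝ, 0 < ρ ∧ ρ < 1 ∧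
      2 * ρ < r₁ ∧ 2 * ρ < r₂ ∧ 2 * ρ < r₃ ∧ 2 * ρ < r₄ ∧ 2 * K₁ * ρ < τ ∧ 4 * K₂ * ρ < τ ∧
      4 * K₃ * M * ρ < τ := by
    have hev : ∀ (b : ℝ) {a : ℝ}, 0 < a → ∀ᶠ ρ in 𝓝[>] (0 : ℝ), b * ρ < a := fun b a ha => by
      have hc : Tendsto (fun ρ : ℝ => b * ρ) (𝓝[>] 0) (𝓝 0) := by
        have : Continuous fun ρ : ℝ => b * ρ := by fun_prop
        simpa using (this.tendsto 0).mono_left nhdsWithin_le_nhds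
      exact hc.eventually_lt_const ha
    have h := (self_mem_nhdsWithin (s := Set.Ioi (0 : ℝ)) (a := 0) : _ ∈ 𝓝[>] (0 : ℝ))
    obtain ⟨ρ, hρ⟩ := ((((((((eventually_of_mem h fun _ h => h).and (hev 1 one_pos)).and
      (hev 2 hr₁)).and (hev 2 hr₂)).and (hev 2 hr₃)).and (hev 2 hr₄)).and
      ((hev (2 * K₁) hτ0).and ((hev (4 * K₂) hτ0).and (hev (4 * K₃ * M) hτ0))))).exists
    obtain ⟨⟨⟨⟨⟨⟨a1, a2⟩, a3⟩, a4⟩, a5⟩, a6⟩, a7, a8, a9⟩ := hρ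
    exact ⟨ρ, a1, by linarith, a3, a4, a5, a6, a7, a8, a9⟩
  have hsub : ball (0 : X × X × ℝ) (2 * ρ) ⊆ V := (ball_subset_ball hρr₄.le).trans hV'
  have hE : ∀ p ∈ ball (0 : X × X × ℝ) (2 * ρ), ∀ p' ∈ ball (0 : X × X × ℝ) (2 * ρ),
      ‖(A p.2.2 p.1 + e p) - (A p'.2.2 p'.1 + e p')‖
        ≤ (lam0 + 2 * τ) * ‖p.1 - p'.1‖ + K₁ * ‖p'.1‖ * ‖p - p'‖ := fun p hp p' hp' =>
    h₁ p (ball_subset_ball hρr₁.le hp) p' (ball_subset_ball hρr₁.le hp')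
  have hF : ∀ p ∈ ball (0 : X × X × ℝ) (2 * ρ), ∀ p' ∈ ball (0 : X × X × ℝ) (2 * ρ), ∀ η η' : X,
      ‖A p.2.2 (η - f p) - A p'.2.2 (η' - f p')‖ ≤ lam0 * ‖η - η'‖ + K₂ * ‖η'‖ * ‖p - p'‖
        + 2 * τ * ‖p.2.1 - p'.2.1‖ + K₂ * ‖p'.2.1‖ * ‖p - p'‖ := fun p hp p' hp' =>
    h₂ p (ball_subset_ball hρr₂.le hp) p' (ball_subset_ball hρr₂.le hp')
  have h0V : (0 : X × X × ℝ) ∈ V := mem_of_mem_nhds hV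
  have hcl : ((lam0 + 3 * τ) / lam) * lam = lam0 + 3 * τ := div_mul_cancel₀ _ hl0.ne'
  have hc1 : (lam0 + 3 * τ) / lam < 1 := by rw [div_lt_one hl0]; linarith
  have hdist : ∀ (d : ℝ) (p p' : X × X × ℝ), 0 ≤ d → ‖p.1 - p'.1‖ ≤ d → ‖p.2.1 - p'.2.1‖ ≤ d →
      ‖p.2.2 - p'.2.2‖ ≤ 2 * d → ‖p - p'‖ ≤ 2 * d := fun d p p' hd hx hy hz => by
    rw [Prod.norm_def, Prod.norm_def]
    exact max_le (hx.trans (by linarith)) (max_le (hy.trans (by linarith)) hz)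
  refine ⟨lam, ρ, (lam0 + 3 * τ) / lam, 4 * K₃ * ρ, hl0, hl1, hρ0, by positivity, hc1,
    by positivity, hsub, ⟨?_, ?_, ?_, ?_, ?_, ?_, ?_, ?_, ?_, ?_⟩, ?_, ?_⟩
  · have h2 : ContDiffOn ℝ 2 (fun p : X × X × ℝ => A p.2.2 p.1 + e p) (ball 0 (2 * ρ)) :=
      (((hA.comp contDiff_snd.snd).clm_apply contDiff_fst).contDiffOn).add (he.mono hsub)
    exact h2.of_le (by norm_num)
  · have h2 : ContDiffOn ℝ 2 (fun q : (X × X × ℝ) × X => A q.1.2.2 (q.2 - f q.1))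
        (ball 0 (2 * ρ) ×ˢ Set.univ) := by
      refine ContDiffOn.clm_apply (hA.comp contDiff_fst.snd.snd).contDiffOn ?_
      exact contDiff_snd.contDiffOn.sub (hf.comp contDiff_fst.contDiffOn fun q hq => hsub hq.1)
    exact h2.of_le (by norm_num)
  · exact (hg.mono hsub).of_le (by norm_num)
  · simp [he0 0 h0V rfl]
  · simp [hf0 0 h0V rfl]
  · exact fun z hz => hg0 _ (hsub hz) (Or.inl rfl)
  · intro a d ha ha1 hd p hp p' hp' hx' hx hy hz
    have hdd := hdist d p p' hd (hx.trans (mul_le_of_le_one_left hd ha1)) hy hz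
    have had : 0 ≤ a * d := mul_nonneg ha hd
    calc _ ≤ (lam0 + 2 * τ) * ‖p.1 - p'.1‖ + K₁ * ‖p'.1‖ * ‖p - p'‖ := hE p hp p' hp'
      _ ≤ (lam0 + 2 * τ) * (a * d) + K₁ * (ρ * a) * (2 * d) := by gcongr
      _ = (lam0 + 2 * τ) * (a * d) + (2 * K₁ * ρ) * (a * d) := by ring
      _ ≤ (lam0 + 2 * τ) * (a * d) + τ * (a * d) := by gcongr
      _ = (lam0 + 3 * τ) * (a * d) := by ring
      _ = _ := by linear_combination (-(a * d)) * hcl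
  · intro a d ha ha1 hd p hp p' hp' η η' hy' hη' hx hy hz hη
    have had : 0 ≤ a * d := mul_nonneg ha hd
    have hlad : lam * a * d ≤ a * d := by nlinarith
    have hdd := hdist d p p' hd hx
      (hy.trans (hlad.trans (mul_le_of_le_one_left hd ha1))) hz
    have hy'' : ‖p'.2.1‖ ≤ ρ * a :=
      hy'.trans (by gcongr; exact mul_le_of_le_one_left ha hl1.le)
    calc _ ≤ lam0 * ‖η - η'‖ + K₂ * ‖η'‖ * ‖p - p'‖ + 2 * τ * ‖p.2.1 - p'.2.1‖
          + K₂ * ‖p'.2.1‖ * ‖p - p'‖ := hF p hp p' hp' η η'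
      _ ≤ lam0 * (a * d) + K₂ * (ρ * a) * (2 * d) + 2 * τ * (a * d)
          + K₂ * (ρ * a) * (2 * d) := by
        have := hy.trans hlad
        gcongr
      _ = (lam0 + 2 * τ) * (a * d) + (4 * K₂ * ρ) * (a * d) := by ring
      _ ≤ (lam0 + 2 * τ) * (a * d) + τ * (a * d) := by gcongr
      _ = (lam0 + 3 * τ) * (a * d) := by ring
      _ = _ := by linear_combination (-(a * d)) * hcl
  · intro a b d ha ha1 hb hb1 hd p hp p' hp' hy hx' hy' hxx hyy hzz
    have habd : 0 ≤ a * b * d := by positivity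
    calc _ ≤ K₃ * (‖p.2.1‖ * ‖p.1 - p'.1‖ + ‖p'.1‖ * ‖p.2.1 - p'.2.1‖
          + ‖p'.1‖ * ‖p'.2.1‖ * ‖p.2.2 - p'.2.2‖) :=
          h₃ p (ball_subset_ball hρr₃.le hp) p' (ball_subset_ball hρr₃.le hp')
      _ ≤ K₃ * ((ρ * b) * (a * d) + (ρ * a) * (b * d) + (ρ * a) * (ρ * b) * (2 * d)) := by gcongr
      _ = K₃ * ρ * ((2 + 2 * ρ) * (a * b * d)) := by ring
      _ ≤ K₃ * ρ * (4 * (a * b * d)) := by gcongr; linarith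
      _ = _ := by ring
  · intro k
    have hc : τ ≤ (lam0 + 3 * τ) / lam := by
      rw [le_div_iff₀ hl0]; nlinarith
    calc k * Real.sqrt lam ^ k * (4 * K₃ * ρ) ≤ M * (4 * K₃ * ρ) := by gcongr; exact hM k
      _ = 4 * K₃ * M * ρ := by ring
      _ ≤ _ := hρK₃.le.trans hc
  · intro p hp
    have hp0 : ((0 : X), p.2) ∈ ball (0 : X × X × ℝ) (2 * ρ) := by
      rw [mem_ball_zero_iff] at hp ⊢
      refine lt_of_le_of_lt ?_ hp
      rw [Prod.norm_def]
      simpa using norm_snd_le p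
    have h := hE p hp (0, p.2) hp0
    rw [he0 _ (hsub hp0) rfl] at h
    simp only [map_zero, add_zero, sub_zero, norm_zero, mul_zero, zero_mul] at h
    exact h.trans (by gcongr; linarith)
  · intro p hp η hy
    have hp0 : (p.1, (0 : X), p.2.2) ∈ ball (0 : X × X × ℝ) (2 * ρ) := by
      rw [mem_ball_zero_iff, Prod.norm_def, Prod.norm_def, max_lt_iff, max_lt_iff] at hp ⊢
      exact ⟨hp.1, by simpa using hρ0, hp.2.2⟩
    have h := hF p hp _ hp0 η 0
    rw [hf0 _ (hsub hp0) rfl, ← hy] at h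
    simp only [map_zero, add_zero, sub_zero, norm_zero, mul_zero, zero_mul] at h
    have hη := norm_nonneg η
    have hy0 : ‖p.2.1‖ * (1 - 2 * τ) ≤ lam * ‖η‖ * (1 - 2 * τ) := by
      have : lam0 ≤ lam * (1 - 2 * τ) := by rw [hlam]; nlinarith
      nlinarith
    exact le_of_mul_le_mul_right hy0 (by linarith)

end NearFixedCurve

open Metric Topology

theorem exists_contDiff_eqOn_ball {E F : Type*} [NormedAddCommGroup E] [NormedSpace ℝ E]
    [HasContDiffBump E] [NormedAddCommGroup F] [NormedSpace ℝ F] {n : ℕ∞} {f : E → F} {r R : ℝ}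
    (hf : ContDiffOn ℝ n f (ball 0 R)) (hr : 0 < r) (hrR : r < R) :
    ∃ f' : E → F, ContDiff ℝ n f' ∧ Set.EqOn f' f (ball 0 r) := by
  let χ : ContDiffBump (0 : E) := ⟨r, (r + R) / 2, hr, by linarith⟩
  refine ⟨fun x => χ x • f x, contDiff_iff_contDiffAt.2 fun x => ?_, fun x hx => ?_⟩
  · by_cases hx : x ∈ ball (0 : E) R
    · exact χ.contDiffAt.smul (hf.contDiffAt (isOpen_ball.mem_nhds hx))
    · have hx' : x ∉ tsupport χ := by
        rw [χ.tsupport_eq]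
        refine fun h => hx (closedBall_subset_ball ?_ h)
        change (r + R) / 2 < R
        linarith
      refine contDiffAt_const (c := (0 : F)) |>.congr_of_eventuallyEq ?_
      filter_upwards [notMem_tsupport_iff_eventuallyEq.1 hx'] with y hy
      simp [hy]
  · simp [χ.one_of_mem_closedBall (ball_subset_closedBall hx)]

section ProdNorm

variable {E F G : Type*} [NormedAddCommGroup E] [NormedSpace ℝ E] [NormedAddCommGroup F]
  [NormedSpace ℝ F] [NormedAddCommGroup G] [NormedSpace ℝ G]

theorem norm_fst_comp_le (L : G →L[ℝ] E × F) : ‖(ContinuousLinearMap.fst ℝ E F).comp L‖ ≤ ‖L‖ :=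
  (ContinuousLinearMap.opNorm_comp_le _ _).trans
    (mul_le_of_le_one_left (norm_nonneg _) (ContinuousLinearMap.norm_fst_le ℝ E F))

theorem norm_snd_comp_le (L : G →L[ℝ] E × F) : ‖(ContinuousLinearMap.snd ℝ E F).comp L‖ ≤ ‖L‖ :=
  (ContinuousLinearMap.opNorm_comp_le _ _).trans
    (mul_le_of_le_one_left (norm_nonneg _) (ContinuousLinearMap.norm_snd_le ℝ E F))

end ProdNorm

/-- Cross-coordinate estimates for iterates near a normally hyperbolic
curve of fixed points.  Let `Pi(x,y,z) = (A(z)x + e, A(z)⁻¹y + f, z + g)` near `0`, with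
`‖A(z)‖ ≤ λ₀ < 1` and remainders `e = O(‖x‖² + ‖x‖‖y‖)`, `f = O(‖y‖² + ‖x‖‖y‖)`,
`g = O(‖x‖‖y‖)`.  Then there are `δ > 0`, `0 < λ < 1`, `C > 0` such that for every `k ≥ 1`
there are `C¹` functions `Rx, Ry, Rz` on the box `Q_δ` expressing the end data
`(x_k, y₀, z_k)` of any orbit segment staying in the `δ`-box as a function of the cross
data `(x₀, y_k, z₀)`, with `|Rx|, ‖DRx‖, |Ry|, ‖DRy‖ ≤ Cλᵏ` and `|Rz|, ‖DRz‖ ≤ Cλ^{k/2}`. -/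
theorem cross_coordinate_estimates {n : ℕ} (hn : 2 ≤ n)
    (A Ainv : ℝ → ((Fin (n - 1) → ℝ) →L[ℝ] (Fin (n - 1) → ℝ)))
    (hA : ContDiff ℝ (⊤ : ℕ∞) A) (hAinv : ContDiff ℝ (⊤ : ℕ∞) Ainv)
    (hAI : ∀ z : ℝ, (A z).comp (Ainv z) = ContinuousLinearMap.id ℝ _ ∧
      (Ainv z).comp (A z) = ContinuousLinearMap.id ℝ _)
    (lam0 r : ℝ) (hlam0 : lam0 < 1) (hr : 0 < r)
    (hAnorm : ∀ z : ℝ, |z| ≤ r → ‖A z‖ ≤ lam0)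
    (V : Set ((Fin (n - 1) → ℝ) × (Fin (n - 1) → ℝ) × ℝ))
    (hVopen : IsOpen V) (hV0 : (0 : (Fin (n - 1) → ℝ) × (Fin (n - 1) → ℝ) × ℝ) ∈ V)
    (e f : (Fin (n - 1) → ℝ) × (Fin (n - 1) → ℝ) × ℝ → (Fin (n - 1) → ℝ))
    (g : (Fin (n - 1) → ℝ) × (Fin (n - 1) → ℝ) × ℝ → ℝ)
    (he : ContDiffOn ℝ (⊤ : ℕ∞) e V) (hf : ContDiffOn ℝ (⊤ : ℕ∞) f V) (hg : ContDiffOn ℝ (⊤ : ℕ∞) g V)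
    (he0 : ∀ p ∈ V, p.1 = 0 → e p = 0)
    (heD : ∀ z : ℝ, ((0 : Fin (n - 1) → ℝ), (0 : Fin (n - 1) → ℝ), z) ∈ V →
      fderiv ℝ (fun x : Fin (n - 1) → ℝ => e (x, 0, z)) 0 = 0)
    (hf0 : ∀ p ∈ V, p.2.1 = 0 → f p = 0)
    (hfD : ∀ z : ℝ, ((0 : Fin (n - 1) → ℝ), (0 : Fin (n - 1) → ℝ), z) ∈ V →
      fderiv ℝ (fun y : Fin (n - 1) → ℝ => f (0, y, z)) 0 = 0)
    (hg0 : ∀ p ∈ V, p.1 = 0 ∨ p.2.1 = 0 → g p = 0)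
    (Pi : (Fin (n - 1) → ℝ) × (Fin (n - 1) → ℝ) × ℝ →
      (Fin (n - 1) → ℝ) × (Fin (n - 1) → ℝ) × ℝ)
    (hPi : ∀ p ∈ V, Pi p = (A p.2.2 p.1 + e p, Ainv p.2.2 p.2.1 + f p, p.2.2 + g p)) :
    ∃ (δ lam C : ℝ), 0 < δ ∧ 0 < lam ∧ lam < 1 ∧ 0 < C ∧
      {q : (Fin (n - 1) → ℝ) × (Fin (n - 1) → ℝ) × ℝ |
        ‖q.1‖ ≤ δ ∧ ‖q.2.1‖ ≤ δ ∧ |q.2.2| ≤ δ} ⊆ V ∧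
      ∀ k : ℕ, 1 ≤ k →
        ∃ (Rx Ry : (Fin (n - 1) → ℝ) × (Fin (n - 1) → ℝ) × ℝ → (Fin (n - 1) → ℝ))
          (Rz : (Fin (n - 1) → ℝ) × (Fin (n - 1) → ℝ) × ℝ → ℝ),
          ContDiff ℝ 1 Rx ∧ ContDiff ℝ 1 Ry ∧ ContDiff ℝ 1 Rz ∧
          -- (1) the end data of an orbit segment staying in the `δ`-box is a function of
          -- the cross data `(x₀, y_k, z₀)`
          (∀ p : ℕ → (Fin (n - 1) → ℝ) × (Fin (n - 1) → ℝ) × ℝ,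
            (∀ i < k, p (i + 1) = Pi (p i)) →
            (∀ i ≤ k, ‖(p i).1‖ ≤ δ ∧ ‖(p i).2.1‖ ≤ δ ∧ |(p i).2.2| ≤ δ) →
            (p k).1 = Rx ((p 0).1, (p k).2.1, (p 0).2.2) ∧
            (p 0).2.1 = Ry ((p 0).1, (p k).2.1, (p 0).2.2) ∧
            (p k).2.2 = (p 0).2.2 + Rz ((p 0).1, (p k).2.1, (p 0).2.2)) ∧
          -- (2) uniform bounds on `Q_δ`, with `C` independent of `k`
          (∀ q : (Fin (n - 1) → ℝ) × (Fin (n - 1) → ℝ) × ℝ,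
            ‖q.1‖ ≤ δ → ‖q.2.1‖ ≤ δ → |q.2.2| ≤ δ →
            ‖Rx q‖ ≤ C * lam ^ k ∧ ‖fderiv ℝ Rx q‖ ≤ C * lam ^ k ∧
            ‖Ry q‖ ≤ C * lam ^ k ∧ ‖fderiv ℝ Ry q‖ ≤ C * lam ^ k ∧
            |Rz q| ≤ C * Real.sqrt lam ^ k ∧ ‖fderiv ℝ Rz q‖ ≤ C * Real.sqrt lam ^ k) := by
  have hV : V ∈ 𝓝 0 := hVopen.mem_nhds hV0
  obtain ⟨lam, ρ, c, κ, h0, h1, hρ, hc, hc1, hκ, hsub, h, hgrowE, hgrowF⟩ :=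
    exists_isCrossContraction (hA.of_le (WithTop.coe_le_coe.2 le_top)) hlam0 hr hAnorm hV
      (he.of_le (WithTop.coe_le_coe.2 le_top)) (hf.of_le (WithTop.coe_le_coe.2 le_top))
      (hg.of_le (WithTop.coe_le_coe.2 le_top)) he0 (heD 0 hV0) hf0 (hfD 0 hV0) hg0
  have hc' : 0 < 1 - c := by linarith
  have hcinv : 0 < (1 - c)⁻¹ := inv_pos.2 hc'
  set δ := (1 - c) * ρ / 3 with hδ
  have hδ0 : 0 < δ := by positivity
  have hδ3 : (1 - c) * ρ = 3 * δ := by rw [hδ]; ring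
  have hδρ : δ < 2 * ρ := by nlinarith
  have hbox : ∀ q : (Fin (n - 1) → ℝ) × (Fin (n - 1) → ℝ) × ℝ,
      ‖q.1‖ ≤ δ → ‖q.2.1‖ ≤ δ → |q.2.2| ≤ δ → ‖q‖ ≤ δ := fun q hx hy hz =>
    norm_prod_le_iff.2 ⟨hx, norm_prod_le_iff.2 ⟨hy, hz⟩⟩
  have hball : ∀ q : (Fin (n - 1) → ℝ) × (Fin (n - 1) → ℝ) × ℝ, ‖q‖ ≤ δ →
      q ∈ ball 0 (2 * ρ) := fun q hq => mem_ball_zero_iff.2 (hq.trans_lt hδρ)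
  refine ⟨δ, lam, ρ + (1 - c)⁻¹, hδ0, h0, h1, by positivity,
    fun q hq => hsub (hball q (hbox q hq.1 hq.2.1 hq.2.2)), fun k _ => ?_⟩
  obtain ⟨S, hS, hSlip, hSρ, hSorb⟩ := h.exists_cross_map h0 h1 hρ hc hc1 hκ k
  rw [hδ3] at hS hSlip hSρ hSorb
  obtain ⟨T, hT, hTS⟩ := exists_contDiff_eqOn_ball hS (r := 2 * δ) (by positivity) (by linarith)
  have hTnorm : ∀ q, ‖q‖ ≤ δ → ‖T q‖ ≤ ρ := fun q hq => by
    rw [hTS (mem_ball_zero_iff.2 (by linarith))]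
    exact hSρ q (mem_ball_zero_iff.2 (by linarith))
  have hTderiv : ∀ q, ‖q‖ ≤ δ → ‖fderiv ℝ T q‖ ≤ (1 - c)⁻¹ := fun q hq => by
    have hq2 : q ∈ ball 0 (2 * δ) := mem_ball_zero_iff.2 (by linarith)
    have hss : ball (0 : (Fin (n - 1) → ℝ) × (Fin (n - 1) → ℝ) × ℝ) (2 * δ) ⊆ ball 0 (3 * δ) :=
      ball_subset_ball (by linarith)
    refine norm_fderiv_le_of_lip' ℝ hcinv.le ?_
    filter_upwards [isOpen_ball.mem_nhds hq2] with q' hq'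
    rw [hTS hq2, hTS hq']
    exact hSlip q' (hss hq') q (hss hq2)
  have hTd : Differentiable ℝ T := hT.differentiable one_ne_zero
  refine ⟨fun q => lam ^ k • (T q).1, fun q => lam ^ k • (T q).2.1,
    fun q => Real.sqrt lam ^ k * (T q).2.2, hT.fst.const_smul _, hT.snd.fst.const_smul _,
    contDiff_const.mul hT.snd.snd, fun p hp hpδ => ?_, fun q hx hy hz => ?_⟩
  · have hpi : ∀ i ≤ k, p i ∈ ball 0 (2 * ρ) := fun i hi =>
      hball _ (hbox _ (hpδ i hi).1 (hpδ i hi).2.1 (hpδ i hi).2.2)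
    have hstep : ∀ i < k, (p (i + 1)).1 = A (p i).2.2 (p i).1 + e (p i) ∧
        (p i).2.1 = A (p i).2.2 ((p (i + 1)).2.1 - f (p i)) ∧
        (p (i + 1)).2.2 = (p i).2.2 + g (p i) := fun i hi => by
      rw [hp i hi, hPi _ (hsub (hpi i hi.le))]
      refine ⟨rfl, ?_, rfl⟩
      rw [add_sub_cancel_right]
      exact (DFunLike.congr_fun (hAI (p i).2.2).1 (p i).2.1).symm
    have hxle : ∀ i ≤ k, ‖(p i).1‖ ≤ lam ^ i * δ := fun i => by
      induction i with
      | zero => intro hi; simpa using (hpδ 0 hi).1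
      | succ i ih =>
        intro hi
        rw [(hstep i hi).1, pow_succ', mul_assoc]
        exact (hgrowE _ (hpi i (by omega))).trans (by gcongr; exact ih (by omega))
    have hyle : ∀ j ≤ k, ‖(p (k - j)).2.1‖ ≤ lam ^ j * δ := fun j => by
      induction j with
      | zero => intro _; simpa using (hpδ k le_rfl).2.1
      | succ j ih =>
        intro hj
        have hj' : k - (j + 1) + 1 = k - j := by omega
        have hy := hgrowF _ (hpi (k - (j + 1)) (by omega)) _ (hstep (k - (j + 1)) (by omega)).2.1
        rw [hj'] at hy
        rw [pow_succ', mul_assoc]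
        exact hy.trans (by gcongr; exact ih (by omega))
    have hcross : ((p 0).1, (p k).2.1, (p 0).2.2) ∈
        ball (0 : (Fin (n - 1) → ℝ) × (Fin (n - 1) → ℝ) × ℝ) (2 * δ) :=
      mem_ball_zero_iff.2 ((hbox ((p 0).1, (p k).2.1, (p 0).2.2) (hpδ 0 k.zero_le).1
        (hpδ k le_rfl).2.1 (hpδ 0 k.zero_le).2.2).trans_lt (by linarith))
    simp only [hTS hcross]
    refine hSorb δ hδ0.le (by linarith) p hstep fun i hi => ⟨hxle i hi, ?_, (hpδ i hi).2.2⟩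
    simpa [Nat.sub_sub_self hi] using hyle (k - i) (Nat.sub_le k i)
  · have hq := hbox q hx hy hz
    have hlk : 0 ≤ lam ^ k := by positivity
    have hsk : 0 ≤ Real.sqrt lam ^ k := by positivity
    have hval : ∀ {a b : ℝ}, 0 ≤ a → b ≤ ‖T q‖ → a * b ≤ (ρ + (1 - c)⁻¹) * a :=
      fun ha hb => by
        rw [mul_comm]
        exact mul_le_mul_of_nonneg_right (hb.trans (by linarith [hTnorm q hq])) ha
    have hder : ∀ {a b : ℝ}, 0 ≤ a → b ≤ ‖fderiv ℝ T q‖ → a * b ≤ (ρ + (1 - c)⁻¹) * a :=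
      fun ha hb => by
        rw [mul_comm]
        exact mul_le_mul_of_nonneg_right (hb.trans (by linarith [hTderiv q hq])) ha
    have hd := (hTd q).hasFDerivAt
    have hdx : HasFDerivAt (fun q => lam ^ k • (T q).1) _ q := hd.fst.const_smul (lam ^ k)
    have hdy : HasFDerivAt (fun q => lam ^ k • (T q).2.1) _ q := hd.snd.fst.const_smul (lam ^ k)
    have hdz : HasFDerivAt (fun q => Real.sqrt lam ^ k * (T q).2.2) _ q :=
      hd.snd.snd.const_mul (Real.sqrt lam ^ k)
    rw [hdx.fderiv, hdy.fderiv, hdz.fderiv, ← Real.norm_eq_abs]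
    simp only [norm_smul, norm_mul, Real.norm_of_nonneg hlk, Real.norm_of_nonneg hsk]
    exact ⟨hval hlk (norm_fst_le _), hder hlk (norm_fst_comp_le _),
      hval hlk ((norm_fst_le _).trans (norm_snd_le _)),
      hder hlk ((norm_fst_comp_le _).trans (norm_snd_comp_le _)),
      hval hsk ((norm_snd_le _).trans (norm_snd_le _)),
      hder hsk ((norm_snd_comp_le _).trans (norm_snd_comp_le _))⟩
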